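/- arXiv:2310.19220 — 15 statements merged into one kernel-verified Lean document; each statement's English description precedes it below -/
import Mathlib

section
/- The function t ↦ Rev(t) = Σ_{ℓ=1}^k n_ℓ Σ_{j=ℓ}^k p_j · e^{−λ Σ_{i=ℓ}^{j−1} t_i} · (1 − e^{−λ t_j}) is concave on the convex set {t ∈ ℝ^k : t_j ≥ 0 for all j}. -/
open Finset

/-- A finite sum of concave functions is concave. -/
theorem concaveOn_sum_fun {E ι : Type*} [AddCommGroup E] [Module ℝ E] {A : Set E}
    (hA : Convex ℝ A) {s : Finset ι} {f : ι → E → ℝ} (hf : ∀ i ∈ s, ConcaveOn ℝ A (f i)) :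
    ConcaveOn ℝ A (fun x => ∑ i ∈ s, f i x) := by
  refine ⟨hA, fun x hx y hy a b ha hb hab => ?_⟩
  rw [smul_sum, smul_sum, ← sum_add_distrib]
  exact sum_le_sum fun i hi => (hf i hi).2 hx hy ha hb hab

/-- The probability of no interaction on the periods `s`, as a function of the policy, is convex. -/
theorem convexOn_exp_neg_mul_sum {ι : Type*} (lam : ℝ) (s : Finset ι) {A : Set (ι → ℝ)}
    (hA : Convex ℝ A) :
    ConvexOn ℝ A (fun t : ι → ℝ => Real.exp (-lam * ∑ i ∈ s, t i)) := by
  refine ⟨hA, fun x _ y _ a b ha hb hab => ?_⟩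
  have h := convexOn_exp.2 (Set.mem_univ (-lam * ∑ i ∈ s, x i))
    (Set.mem_univ (-lam * ∑ i ∈ s, y i)) ha hb hab
  convert h using 2
  simp only [Pi.add_apply, Pi.smul_apply, smul_eq_mul, sum_add_distrib, ← mul_sum]
  ring

/-- The revenue from a single customer of class `l` up to period `m`, plus the last price times the
probability that the customer has not bought by then, is concave. -/
theorem concaveOn_revenue_add_residual (lam : ℝ) (p : ℕ → ℝ) {A : Set (ℕ → ℝ)}
    (hA : Convex ℝ A) {l m : ℕ} (hl : 1 ≤ l) (hlm : l ≤ m)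
    (hp : ∀ j, l ≤ j → j < m → p (j + 1) ≤ p j) :
    ConcaveOn ℝ A (fun t : ℕ → ℝ =>
      ∑ j ∈ Icc l m, p j * Real.exp (-lam * ∑ i ∈ Icc l (j - 1), t i)
        * (1 - Real.exp (-lam * t j)) + p m * Real.exp (-lam * ∑ i ∈ Icc l m, t i)) := by
  induction m, hlm using Nat.le_induction with
  | base =>
    refine (concaveOn_const (p l) hA).congr fun t _ => ?_
    have h : Icc l (l - 1) = ∅ := Icc_eq_empty (by omega)
    simp only [Icc_self, sum_singleton, h, sum_empty, mul_zero, Real.exp_zero]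
    ring
  | succ m hlm ih =>
    have hstep : 0 ≤ p m - p (m + 1) := sub_nonneg.2 (hp m hlm (Nat.lt_succ_self m))
    refine ((ih fun j hj hjm => hp j hj (by omega)).sub
      ((convexOn_exp_neg_mul_sum lam (Icc l m) hA).smul hstep)).congr fun t _ => ?_
    simp only [sum_Icc_succ_top (Nat.le_succ_of_le hlm), Nat.add_sub_cancel, mul_add,
      Real.exp_add, Pi.sub_apply, smul_eq_mul]
    ring

/-- Proposition 3 (Concavity of the revenue function): the expected revenue of a
non-adaptive markdown policy `t` is concave on the nonnegative orthant. -/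
theorem revenue_concave (k : ℕ) (hk : 1 ≤ k) (lam : ℝ) (hlam : 0 < lam)
    (p n : ℕ → ℝ) (hp : ∀ j ∈ Icc 1 k, 0 < p j)
    (hpmono : ∀ j ∈ Icc 1 (k - 1), p (j + 1) ≤ p j)
    (hn : ∀ j ∈ Icc 1 k, 0 ≤ n j) :
    ConcaveOn ℝ {t : ℕ → ℝ | ∀ j, 0 ≤ t j}
      (fun t : ℕ → ℝ =>
        ∑ l ∈ Icc 1 k, n l *
          ∑ j ∈ Icc l k, p j * Real.exp (-lam * ∑ i ∈ Icc l (j - 1), t i)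
            * (1 - Real.exp (-lam * t j))) := by
  have hA : Convex ℝ {t : ℕ → ℝ | ∀ j, 0 ≤ t j} := convex_Ici (0 : ℕ → ℝ)
  refine concaveOn_sum_fun hA fun l hl => ?_
  obtain ⟨hl1, hlk⟩ := mem_Icc.1 hl
  refine ConcaveOn.smul (hn l hl) ?_
  refine ((concaveOn_revenue_add_residual lam p hA hl1 hlk fun j hj hjk =>
    hpmono j (mem_Icc.2 ⟨by omega, by omega⟩)).sub
    ((convexOn_exp_neg_mul_sum lam (Icc l k) hA).smul
      (hp k (mem_Icc.2 ⟨hk, le_rfl⟩)).le)).congr fun t _ => ?_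
  simp only [Pi.sub_apply, smul_eq_mul]
  ring
end

section
/- For every ℓ ∈ {1,…,k} and every t ∈ ℝ^k, the k×k matrix H whose entry H_{ij} equals −Σ_{s=max(i,j)}^k λ²·(p_s − p_{s+1})·e^{−λ Σ_{u=ℓ}^{s} t_u} when ℓ ≤ i ≤ k and ℓ ≤ j ≤ k, and equals 0 otherwise, satisfies: (a) H_{ij} is the second partial derivative ∂²r_ℓ/∂t_i∂t_j at t, and (b) H is negative semidefinite, i.e., xᵀ H x ≤ 0 for every x ∈ ℝ^k. -/
open Finset

/-- A linear combination, with coefficients `c s`, of exponentials of the partial sums of `t`. -/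
noncomputable def expPartialSums (l k : ℕ) (lam : ℝ) (c t : ℕ → ℝ) : ℝ :=
  ∑ s ∈ Icc l k, c s * Real.exp (-lam * ∑ u ∈ Icc l s, t u)

lemma hasDerivAt_sum_update {ι : Type*} [DecidableEq ι] (S : Finset ι) (t : ι → ℝ) (j : ι)
    (y : ℝ) :
    HasDerivAt (fun y => ∑ u ∈ S, Function.update t j y u) (if j ∈ S then 1 else 0) y := by
  have h : ∀ u ∈ S, HasDerivAt (fun y => Function.update t j y u) (if u = j then 1 else 0) y := by
    intro u _
    by_cases huj : u = j
    · subst huj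
      simpa using hasDerivAt_id' y
    · simpa [huj] using hasDerivAt_const y (t u)
  simpa using HasDerivAt.fun_sum h

lemma hasDerivAt_expPartialSums (l k : ℕ) (lam : ℝ) (c t : ℕ → ℝ) (j : ℕ) (y : ℝ) :
    HasDerivAt (fun y => expPartialSums l k lam c (Function.update t j y))
      (expPartialSums l k lam (fun s => c s * (-lam * if j ∈ Icc l s then 1 else 0))
        (Function.update t j y)) y := by
  refine HasDerivAt.fun_sum fun s _ => ?_
  refine ((((hasDerivAt_sum_update (Icc l s) t j y).const_mul (-lam)).exp).const_mul
    (c s)).congr_deriv ?_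
  ring

/-- Summation by parts. -/
lemma sum_Icc_mul_sub (p E : ℕ → ℝ) {l k : ℕ} (hlk : l ≤ k) :
    ∑ j ∈ Icc l k, p j * (E (j - 1) - E j) =
      p l * E (l - 1) - p (k + 1) * E k + ∑ j ∈ Icc l k, -(p j - p (j + 1)) * E j := by
  induction k, hlk using Nat.le_induction with
  | base => simp; ring
  | succ n hn ih =>
    rw [sum_Icc_succ_top (by omega), sum_Icc_succ_top (by omega), ih]
    simp only [Nat.add_sub_cancel]
    ring

lemma ite_sum_Icc_max (l k i j : ℕ) (f : ℕ → ℝ) :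
    (if l ≤ i ∧ i ≤ k ∧ l ≤ j ∧ j ≤ k then -∑ s ∈ Icc (max i j) k, f s else 0) =
      -∑ s ∈ Icc l k, f s * ((if i ∈ Icc l s then 1 else 0) * if j ∈ Icc l s then 1 else 0) := by
  simp only [mul_one, mul_ite, mul_zero, ← ite_and, ← sum_filter]
  split_ifs with h
  · congr 2
    ext s
    simp only [mem_Icc, mem_filter]
    omega
  · rw [filter_false_of_mem, sum_empty, neg_zero]
    intro s hs
    simp only [mem_Icc] at hs ⊢
    omega

/-- A nonpositive combination of squares of linear forms, written as a quadratic form. -/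
lemma sum_sum_mul_neg_sum_mul_nonpos {ι κ : Type*} (A : Finset ι) (S : Finset κ) (w : κ → ℝ)
    (hw : ∀ s ∈ S, 0 ≤ w s) (a : ι → κ → ℝ) (x : ι → ℝ) :
    ∑ i ∈ A, ∑ j ∈ A, x i * (-∑ s ∈ S, w s * (a i s * a j s)) * x j ≤ 0 := by
  have h : ∑ i ∈ A, ∑ j ∈ A, x i * (-∑ s ∈ S, w s * (a i s * a j s)) * x j =
      -∑ s ∈ S, w s * (∑ i ∈ A, x i * a i s) ^ 2 := by
    simp only [sq, mul_sum, sum_mul, mul_neg, neg_mul, sum_neg_distrib]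
    rw [sum_comm (s := S)]
    congr 1
    refine sum_congr rfl fun i _ => ?_
    rw [sum_comm (s := S)]
    exact sum_congr rfl fun j _ => sum_congr rfl fun s _ => by ring
  rw [h, neg_nonpos]
  exact sum_nonneg fun s hs => mul_nonneg (hw s hs) (sq_nonneg _)

/-- Hessian of the per-type revenue `r_ℓ` (second half of Lemma 4):
(a) the second partial derivatives of `r_ℓ` are given by the matrix `H` with
`H_{ij} = −Σ_{s=max(i,j)}^k λ² (p_s − p_{s+1}) e^{−λ Σ_{u=ℓ}^{s} t_u}` for
`ℓ ≤ i, j ≤ k` and `0` otherwise, and (b) `H` is negative semidefinite.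
Here `p_{k+1} := 0`. -/
theorem hessian_r (k : ℕ) (hk : 1 ≤ k) (lam : ℝ) (hlam : 0 < lam)
    (p : ℕ → ℝ) (hp : ∀ j ∈ Icc 1 k, 0 < p j)
    (hpmono : ∀ j ∈ Icc 1 (k - 1), p (j + 1) ≤ p j)
    (hpk1 : p (k + 1) = 0)
    (l : ℕ) (hl : l ∈ Icc 1 k) (t : ℕ → ℝ) :
    let rl : (ℕ → ℝ) → ℝ := fun t' =>
      ∑ j' ∈ Icc l k, p j' *
        (Real.exp (-lam * ∑ i ∈ Icc l (j' - 1), t' i)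
          - Real.exp (-lam * ∑ i ∈ Icc l j', t' i));
    let H : ℕ → ℕ → ℝ := fun i j =>
      if l ≤ i ∧ i ≤ k ∧ l ≤ j ∧ j ≤ k then
        -∑ s ∈ Icc (max i j) k, lam ^ 2 * (p s - p (s + 1))
          * Real.exp (-lam * ∑ u ∈ Icc l s, t u)
      else 0;
    (∀ i ∈ Icc 1 k, ∀ j ∈ Icc 1 k,
      HasDerivAt
        (fun x : ℝ =>
          deriv (fun y : ℝ => rl (Function.update (Function.update t i x) j y))
            (Function.update t i x j))
        (H i j) (t i))
    ∧ (∀ x : ℕ → ℝ, ∑ i ∈ Icc 1 k, ∑ j ∈ Icc 1 k, x i * H i j * x j ≤ 0) := by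
  intro rl H
  obtain ⟨hl1, hlk⟩ := mem_Icc.mp hl
  have hrl : ∀ t', rl t' = p l + expPartialSums l k lam (fun s => -(p s - p (s + 1))) t' := by
    intro t'
    have h := sum_Icc_mul_sub p (fun s => Real.exp (-lam * ∑ i ∈ Icc l s, t' i)) hlk
    have hempty : Icc l (l - 1) = ∅ := Icc_eq_empty (by omega)
    simpa [rl, expPartialSums, hpk1, hempty] using h
  have hH : ∀ i j, H i j = -∑ s ∈ Icc l k, (lam ^ 2 * (p s - p (s + 1))
      * Real.exp (-lam * ∑ u ∈ Icc l s, t u))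
      * ((if i ∈ Icc l s then 1 else 0) * if j ∈ Icc l s then 1 else 0) :=
    fun i j => ite_sum_Icc_max l k i j _
  constructor
  · intro i _ j _
    have hderiv : ∀ x : ℝ,
        deriv (fun y : ℝ => rl (Function.update (Function.update t i x) j y))
          (Function.update t i x j) =
        expPartialSums l k lam
          (fun s => -(p s - p (s + 1)) * (-lam * if j ∈ Icc l s then 1 else 0))
          (Function.update t i x) := by
      intro x
      simp only [hrl]
      rw [((hasDerivAt_expPartialSums l k lam _ _ j _).const_add (p l)).deriv,
        Function.update_eq_self]
    simp only [hderiv]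
    convert hasDerivAt_expPartialSums l k lam _ t i (t i) using 1
    rw [hH, Function.update_eq_self, expPartialSums, ← sum_neg_distrib]
    exact sum_congr rfl fun s _ => by ring
  · intro x
    simp only [hH]
    refine sum_sum_mul_neg_sum_mul_nonpos (Icc 1 k) (Icc l k) _ (fun s hs => ?_)
      (fun i s => if i ∈ Icc l s then 1 else 0) x
    obtain ⟨hls, hsk⟩ := mem_Icc.mp hs
    have hp_anti : 0 ≤ p s - p (s + 1) := by
      rcases hsk.eq_or_lt with rfl | hlt
      · simpa [hpk1] using (hp s (mem_Icc.mpr ⟨hk, le_rfl⟩)).le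
      · exact sub_nonneg.mpr (hpmono s (mem_Icc.mpr ⟨by omega, by omega⟩))
    positivity
end

section
/- For every ℓ ∈ {1,…,k} and every t ∈ ℝ^k with t_j ≥ 0 for all j and Σ_{j=1}^k t_j = 1, it holds that r_ℓ(t) = Σ_{j=ℓ}^k p_j (e^{−λ Σ_{i=ℓ}^{j−1} t_i} − e^{−λ Σ_{i=ℓ}^{j} t_i}) ≥ (1 − e^{−λ}) · Σ_{j=ℓ}^k p_j t_j. -/
open Finset

/-- Summation by parts: for nonincreasing weights `p`, the weighted increments of a nonnegative
sequence `g` starting from zero sum to at least the final weight times the final value. -/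
theorem mul_le_sum_mul_sub_of_antitone {p g : ℕ → ℝ} {l n : ℕ} (hln : l ≤ n)
    (hp : ∀ j, l ≤ j → j < n → p (j + 1) ≤ p j) (hg0 : g (l - 1) = 0)
    (hg : ∀ j, l ≤ j → j < n → 0 ≤ g j) :
    p n * g n ≤ ∑ j ∈ Icc l n, p j * (g j - g (j - 1)) := by
  induction n, hln using Nat.le_induction with
  | base => simp [hg0]
  | succ n hln ih =>
    rw [sum_Icc_succ_top (by omega), Nat.add_sub_cancel]
    have hn := ih (fun j hj hjn => hp j hj (by omega)) (fun j hj hjn => hg j hj (by omega))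
    have hmul := mul_le_mul_of_nonneg_right (hp n hln (by omega)) (hg n hln (by omega))
    linarith

/-- On `[0, 1]` the function `x ↦ 1 - exp (-a * x)` lies above its chord. -/
theorem one_sub_exp_neg_mul_le (a : ℝ) {x : ℝ} (hx0 : 0 ≤ x) (hx1 : x ≤ 1) :
    (1 - Real.exp (-a)) * x ≤ 1 - Real.exp (-a * x) := by
  have h := convexOn_exp.2 (Set.mem_univ 0) (Set.mem_univ (-a)) (sub_nonneg.2 hx1) hx0
    (sub_add_cancel 1 x)
  simp only [smul_eq_mul, mul_zero, zero_add, Real.exp_zero, mul_one] at h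
  rw [mul_comm x (-a)] at h
  linarith

/-- Jensen-type lower bound on the per-type revenue (key step of Lemma 5):
`r_ℓ(t) ≥ (1 − e^{−λ}) Σ_{j=ℓ}^k p_j t_j` for `t` in the probability simplex. -/
theorem r_ge_linear (k : ℕ) (hk : 1 ≤ k) (lam : ℝ) (hlam : 0 < lam)
    (p : ℕ → ℝ) (hp : ∀ j ∈ Icc 1 k, 0 < p j)
    (hpmono : ∀ j ∈ Icc 1 (k - 1), p (j + 1) ≤ p j)
    (l : ℕ) (hl : l ∈ Icc 1 k)
    (t : ℕ → ℝ) (ht0 : ∀ j ∈ Icc 1 k, 0 ≤ t j) (ht1 : ∑ j ∈ Icc 1 k, t j = 1) :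
    (1 - Real.exp (-lam)) * ∑ j ∈ Icc l k, p j * t j
      ≤ ∑ j ∈ Icc l k, p j *
          (Real.exp (-lam * ∑ i ∈ Icc l (j - 1), t i)
            - Real.exp (-lam * ∑ i ∈ Icc l j, t i)) := by
  obtain ⟨hl1, hlk⟩ := mem_Icc.1 hl
  set S : ℕ → ℝ := fun j => ∑ i ∈ Icc l j, t i with hS
  set g : ℕ → ℝ := fun j => 1 - Real.exp (-lam * S j) - (1 - Real.exp (-lam)) * S j with hg
  have hg_nonneg : ∀ j ≤ k, 0 ≤ g j := by
    intro j hj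
    have hsub : Icc l j ⊆ Icc 1 k := Icc_subset_Icc hl1 hj
    have hS0 : 0 ≤ S j := sum_nonneg fun i hi => ht0 i (hsub hi)
    have hS1 : S j ≤ 1 := ht1 ▸ sum_le_sum_of_subset_of_nonneg hsub fun i hi _ => ht0 i hi
    exact sub_nonneg.2 (one_sub_exp_neg_mul_le lam hS0 hS1)
  have hg_zero : g (l - 1) = 0 := by
    have hS_zero : S (l - 1) = 0 := by
      simp only [hS]
      rw [Icc_eq_empty (by omega), sum_empty]
    simp [hg, hS_zero]
  have hparts := mul_le_sum_mul_sub_of_antitone hlk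
    (fun j hj hjk => hpmono j (mem_Icc.2 ⟨by omega, by omega⟩)) hg_zero
    (fun j _ hjk => hg_nonneg j hjk.le)
  have hlast : 0 ≤ p k * g k :=
    mul_nonneg (hp k (mem_Icc.2 ⟨hk, le_rfl⟩)).le (hg_nonneg k le_rfl)
  rw [← sub_nonneg, mul_sum, ← sum_sub_distrib]
  refine (hlast.trans hparts).trans_eq (sum_congr rfl fun j hj => ?_)
  obtain ⟨hlj, -⟩ := mem_Icc.1 hj
  have hstep : S j = S (j - 1) + t j := by
    obtain ⟨m, rfl⟩ : ∃ m, j = m + 1 := ⟨j - 1, by omega⟩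
    exact sum_Icc_succ_top hlj t
  have ht : t j = S j - S (j - 1) := by linarith
  simp only [hg, ht]
  ring
end

section
/- Suppose Σ_{j=1}^k n_j p_j > 0. Then for every non-adaptive markdown policy t (i.e., t_j ≥ 0 for all j and Σ_{j=1}^k t_j = 1), Rev(t)/UB ≥ (Σ_{ℓ=1}^k n_ℓ Σ_{j=ℓ}^k p_j t_j)/(Σ_{j=1}^k n_j p_j); equivalently, Rev(t) ≥ (1 − e^{−λ}) · Σ_{ℓ=1}^k n_ℓ Σ_{j=ℓ}^k p_j t_j. -/
open Finset

/-- The chord of `x ↦ 1 - exp (-c * x)` over `[0, 1]` lies below its graph. -/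
lemma one_sub_exp_neg_mul_le_s6 (c : ℝ) {x : ℝ} (h0 : 0 ≤ x) (h1 : x ≤ 1) :
    (1 - Real.exp (-c)) * x ≤ 1 - Real.exp (-c * x) := by
  have h := convexOn_exp.2 (Set.mem_univ (0 : ℝ)) (Set.mem_univ (-c))
    (sub_nonneg.2 h1) h0 (by ring)
  simp only [smul_eq_mul, mul_zero, zero_add, Real.exp_zero] at h
  rw [mul_comm x (-c)] at h
  linarith

/-- Summation by parts: the revenue collected on `[l, m]` exceeds its linearization by at least
the last price times the gap between `x ↦ 1 - exp (-c * x)` and its chord at the total time. -/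
lemma linearized_revenue_add_le (c : ℝ) (p t : ℕ → ℝ) {l k : ℕ} (hl : 1 ≤ l)
    (hpmono : ∀ j ∈ Ico l k, p (j + 1) ≤ p j)
    (ht : ∀ m ∈ Icc l k, 0 ≤ ∑ i ∈ Icc l m, t i ∧ ∑ i ∈ Icc l m, t i ≤ 1)
    (m : ℕ) (hlm : l ≤ m) (hmk : m ≤ k) :
    (1 - Real.exp (-c)) * ∑ j ∈ Icc l m, p j * t j
        + p m * (1 - Real.exp (-c * ∑ i ∈ Icc l m, t i)
            - (1 - Real.exp (-c)) * ∑ i ∈ Icc l m, t i)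
      ≤ ∑ j ∈ Icc l m, p j * Real.exp (-c * ∑ i ∈ Icc l (j - 1), t i)
          * (1 - Real.exp (-c * t j)) := by
  induction m, hlm using Nat.le_induction with
  | base =>
    have he : Icc l (l - 1) = ∅ := Icc_eq_empty (by omega)
    simp only [Icc_self, sum_singleton, he, sum_empty, mul_zero, Real.exp_zero]
    apply le_of_eq
    ring
  | succ m hlm ih =>
    have hm := ih (by omega)
    obtain ⟨h0, h1⟩ := ht m (mem_Icc.2 ⟨hlm, by omega⟩)
    have hgap := mul_le_mul_of_nonneg_right (hpmono m (mem_Ico.2 ⟨hlm, by omega⟩))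
      (sub_nonneg.2 (one_sub_exp_neg_mul_le_s6 c h0 h1))
    simp only [sum_Icc_succ_top (show l ≤ m + 1 by omega), Nat.add_sub_cancel, mul_add,
      Real.exp_add]
    linarith

/-- Lemma 5 (Linearization reduces the objective): `Rev(t)/UB ≥ Rev'(t)/UB'`,
i.e. `Rev(t) ≥ (1 − e^{−λ}) Σ_ℓ n_ℓ Σ_{j=ℓ}^k p_j t_j`. -/
theorem linearization_bound (k : ℕ) (hk : 1 ≤ k) (lam : ℝ) (hlam : 0 < lam)
    (p n : ℕ → ℝ) (hp : ∀ j ∈ Icc 1 k, 0 < p j)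
    (hpmono : ∀ j ∈ Icc 1 (k - 1), p (j + 1) ≤ p j)
    (hn : ∀ j ∈ Icc 1 k, 0 ≤ n j)
    (hpos : 0 < ∑ j ∈ Icc 1 k, n j * p j)
    (t : ℕ → ℝ) (ht0 : ∀ j ∈ Icc 1 k, 0 ≤ t j) (ht1 : ∑ j ∈ Icc 1 k, t j = 1) :
    (∑ l ∈ Icc 1 k, n l * ∑ j ∈ Icc l k, p j * t j)
        / (∑ j ∈ Icc 1 k, n j * p j)
      ≤ (∑ l ∈ Icc 1 k, n l *
            ∑ j ∈ Icc l k, p j * Real.exp (-lam * ∑ i ∈ Icc l (j - 1), t i)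
              * (1 - Real.exp (-lam * t j)))
          / (∑ j ∈ Icc 1 k, n j * p j * (1 - Real.exp (-lam)))
    ∧ (1 - Real.exp (-lam)) * ∑ l ∈ Icc 1 k, n l * ∑ j ∈ Icc l k, p j * t j
      ≤ ∑ l ∈ Icc 1 k, n l *
          ∑ j ∈ Icc l k, p j * Real.exp (-lam * ∑ i ∈ Icc l (j - 1), t i)
            * (1 - Real.exp (-lam * t j)) := by
  have hexp : 0 < 1 - Real.exp (-lam) := sub_pos.2 (Real.exp_lt_one_iff.2 (by linarith))
  have hmain : (1 - Real.exp (-lam)) * ∑ l ∈ Icc 1 k, n l * ∑ j ∈ Icc l k, p j * t j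
      ≤ ∑ l ∈ Icc 1 k, n l *
          ∑ j ∈ Icc l k, p j * Real.exp (-lam * ∑ i ∈ Icc l (j - 1), t i)
            * (1 - Real.exp (-lam * t j)) := by
    rw [mul_sum]
    refine sum_le_sum fun l hl => ?_
    rw [mul_left_comm]
    refine mul_le_mul_of_nonneg_left ?_ (hn l hl)
    obtain ⟨hl1, hlk⟩ := mem_Icc.1 hl
    have ht : ∀ m ∈ Icc l k, 0 ≤ ∑ i ∈ Icc l m, t i ∧ ∑ i ∈ Icc l m, t i ≤ 1 := by
      intro m hm
      have hsub : Icc l m ⊆ Icc 1 k := Icc_subset_Icc hl1 (mem_Icc.1 hm).2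
      exact ⟨sum_nonneg fun i hi => ht0 i (hsub hi),
        ht1 ▸ sum_le_sum_of_subset_of_nonneg hsub fun i hi _ => ht0 i hi⟩
    have hrev := linearized_revenue_add_le lam p t hl1
      (fun j hj => hpmono j (by rw [mem_Ico] at hj; rw [mem_Icc]; omega)) ht k hlk le_rfl
    obtain ⟨h0, h1⟩ := ht k (mem_Icc.2 ⟨hlk, le_rfl⟩)
    have hgap := mul_nonneg (hp k (mem_Icc.2 ⟨hk, le_rfl⟩)).le
      (sub_nonneg.2 (one_sub_exp_neg_mul_le_s6 lam h0 h1))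
    linarith
  refine ⟨?_, hmain⟩
  rw [← sum_mul, div_le_div_iff₀ hpos (mul_pos hpos hexp)]
  have h := mul_le_mul_of_nonneg_left hmain hpos.le
  linarith
end

section
/- Let p_1 ≥ p_2 ≥ ⋯ ≥ p_k > 0 and define the robust policy t* by t*_k = 1/(k − Σ_{j=1}^{k−1} p_{j+1}/p_j) and t*_j = (1 − p_{j+1}/p_j)·t*_k for j = 1, …, k−1. Then: (a) k − Σ_{j=1}^{k−1} p_{j+1}/p_j ≥ 1, so t*_k is well defined and 0 < t*_k ≤ 1; (b) t*_j ≥ 0 for all j and Σ_{j=1}^k t*_j = 1; and (c) for every i ∈ {1,…,k}, (Σ_{j=i}^k p_j t*_j)/p_i = t*_k. -/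
open Finset

theorem sum_Icc_sub_succ (f : ℕ → ℝ) {i m : ℕ} (h : i ≤ m + 1) :
    ∑ j ∈ Icc i m, (f j - f (j + 1)) = f i - f (m + 1) := by
  induction m with
  | zero =>
    obtain rfl | rfl : i = 0 ∨ i = 1 := by lia
    · simp
    · simp
  | succ m ih =>
    obtain rfl | hi : i = m + 1 + 1 ∨ i ≤ m + 1 := by lia
    · simp
    · rw [sum_Icc_succ_top hi, ih hi]
      ring

/-- Properties of the robust policy `t*` (Definition 4 / solution of the LP (P2)):
(a) `k − Σ_{j<k} p_{j+1}/p_j ≥ 1`, so `0 < t*_k ≤ 1`; (b) `t*` lies in the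
probability simplex; (c) all `k` ratio constraints are binding:
`(Σ_{j=i}^k p_j t*_j)/p_i = t*_k` for every `i`. -/
theorem robust_policy_props (k : ℕ) (hk : 1 ≤ k)
    (p : ℕ → ℝ) (hp : ∀ j ∈ Icc 1 k, 0 < p j)
    (hpmono : ∀ j ∈ Icc 1 (k - 1), p (j + 1) ≤ p j)
    (tstar : ℕ → ℝ)
    (htk : tstar k = 1 / ((k : ℝ) - ∑ j ∈ Icc 1 (k - 1), p (j + 1) / p j))
    (htj : ∀ j ∈ Icc 1 (k - 1), tstar j = (1 - p (j + 1) / p j) * tstar k) :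
    (1 ≤ (k : ℝ) - ∑ j ∈ Icc 1 (k - 1), p (j + 1) / p j
      ∧ 0 < tstar k ∧ tstar k ≤ 1)
    ∧ (∀ j ∈ Icc 1 k, 0 ≤ tstar j)
    ∧ (∑ j ∈ Icc 1 k, tstar j = 1)
    ∧ (∀ i ∈ Icc 1 k, (∑ j ∈ Icc i k, p j * tstar j) / p i = tstar k) := by
  obtain ⟨m, rfl⟩ : ∃ m, k = m + 1 := ⟨k - 1, by lia⟩
  simp only [Nat.add_sub_cancel] at *
  have pos : ∀ j, 1 ≤ j → j ≤ m + 1 → 0 < p j := fun j h₁ h₂ => hp j (mem_Icc.2 ⟨h₁, h₂⟩)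
  have ratio_le : ∀ j ∈ Icc 1 m, p (j + 1) / p j ≤ 1 := fun j hj => by
    have hj' := mem_Icc.1 hj
    exact (div_le_one (pos j hj'.1 (by lia))).2 (hpmono j hj)
  have sum_le : ∑ j ∈ Icc 1 m, p (j + 1) / p j ≤ m := by
    simpa using sum_le_sum ratio_le
  have denom : 1 ≤ ((m + 1 : ℕ) : ℝ) - ∑ j ∈ Icc 1 m, p (j + 1) / p j := by
    push_cast
    linarith
  have t_pos : 0 < tstar (m + 1) := by
    rw [htk]
    exact one_div_pos.2 (by linarith)
  refine ⟨⟨denom, t_pos, ?_⟩, fun j hj => ?_, ?_, fun i hi => ?_⟩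
  · rw [htk]
    exact (div_le_one (by linarith)).2 denom
  · have hj' := mem_Icc.1 hj
    obtain rfl | hjm : j = m + 1 ∨ j ≤ m := by lia
    · exact t_pos.le
    · have hjm' : j ∈ Icc 1 m := mem_Icc.2 ⟨hj'.1, hjm⟩
      rw [htj j hjm']
      exact mul_nonneg (sub_nonneg.2 (ratio_le j hjm')) t_pos.le
  · rw [sum_Icc_succ_top (by lia), sum_congr rfl htj, ← sum_mul, sum_sub_distrib]
    have h := (eq_div_iff (by linarith)).1 htk
    push_cast at h
    simp only [sum_const, Nat.card_Icc, Nat.add_sub_cancel, nsmul_eq_mul, mul_one]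
    linarith
  · have hi' := mem_Icc.1 hi
    have hterm : ∀ j ∈ Icc i m, p j * tstar j = (p j - p (j + 1)) * tstar (m + 1) := by
      intro j hj
      have hj' := mem_Icc.1 hj
      have := (pos j (by lia) (by lia)).ne'
      rw [htj j (mem_Icc.2 ⟨by lia, hj'.2⟩)]
      field_simp
    rw [sum_Icc_succ_top hi'.2, sum_congr rfl hterm, ← sum_mul, sum_Icc_sub_succ p hi'.2,
      div_eq_iff (pos i hi'.1 hi'.2).ne']
    ring
end

section
/- Let p_1 ≥ p_2 ≥ ⋯ ≥ p_k > 0 and let t* be the robust policy with t*_k = 1/(k − Σ_{j=1}^{k−1} p_{j+1}/p_j) and t*_j = (1 − p_{j+1}/p_j)·t*_k for j < k. Then for every interaction rate λ > 0 and all nonnegative customer counts n_1, …, n_k, Rev(t*) ≥ UB/(k − Σ_{j=1}^{k−1} p_{j+1}/p_j) ≥ UB/k. -/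
open Finset

/-- Chord bound for the concave function `s ↦ 1 - e^{-λ s}` on `[0, 1]`. -/
theorem mul_one_sub_exp_neg_le (lam : ℝ) {s : ℝ} (hs0 : 0 ≤ s) (hs1 : s ≤ 1) :
    s * (1 - Real.exp (-lam)) ≤ 1 - Real.exp (-lam * s) := by
  have h := convexOn_exp.2 (Set.mem_univ 0) (Set.mem_univ (-lam)) (sub_nonneg.2 hs1) hs0
    (sub_add_cancel 1 s)
  simp only [smul_eq_mul, mul_zero, zero_add, Real.exp_zero, mul_one, mul_comm s (-lam)] at h
  linarith

/-- Revenue collected from a customer of type `l` before price `m` is offered, when the time spent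
on each price is `c` times the relative price drop. -/
theorem le_sum_Ico_revenue (lam c : ℝ) (p t : ℕ → ℝ) {l m : ℕ} (hlm : l ≤ m)
    (hmono : ∀ j ∈ Ico l m, p (j + 1) ≤ p j)
    (ht : ∀ j ∈ Ico l m, p j * t j = c * (p j - p (j + 1)))
    (ht0 : ∀ j ∈ Ico l m, 0 ≤ t j) (hsum : ∑ i ∈ Ico l m, t i ≤ 1) :
    p m * (1 - Real.exp (-lam * ∑ i ∈ Ico l m, t i))
        + (1 - Real.exp (-lam)) * (c * (p l - p m) - p m * ∑ i ∈ Ico l m, t i)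
      ≤ ∑ j ∈ Ico l m, p j * Real.exp (-lam * ∑ i ∈ Ico l j, t i)
          * (1 - Real.exp (-lam * t j)) := by
  induction m, hlm using Nat.le_induction with
  | base => simp
  | succ m hlm ih =>
    have hm : m ∈ Ico l (m + 1) := mem_Ico.2 ⟨hlm, m.lt_succ_self⟩
    have hsub : ∀ j ∈ Ico l m, j ∈ Ico l (m + 1) := fun j hj =>
      Ico_subset_Ico_right m.le_succ hj
    have hS0 := sum_nonneg ht0
    have hchord := mul_one_sub_exp_neg_le lam hS0 hsum
    have htm := ht m hm
    have hdrop := mul_le_mul_of_nonneg_left hchord (sub_nonneg.2 (hmono m hm))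
    rw [sum_Ico_succ_top hlm] at hsum hdrop ⊢
    rw [sum_Ico_succ_top hlm]
    have hih := ih (fun j hj => hmono j (hsub j hj)) (fun j hj => ht j (hsub j hj))
      (fun j hj => ht0 j (hsub j hj)) (by linarith [ht0 m hm])
    rw [mul_add (-lam), Real.exp_add] at hdrop ⊢
    linear_combination hih + hdrop - (1 - Real.exp (-lam)) * htm

/-- Theorem 3 (Competitive non-adaptive policy): the robust policy `t*` earns
at least a `1/(k − Σ_{j<k} p_{j+1}/p_j) ≥ 1/k` fraction of the upper bound
`UB = Σ_j n_j p_j (1 − e^{−λ})`. -/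
theorem robust_policy_competitive (k : ℕ) (hk : 1 ≤ k) (lam : ℝ) (hlam : 0 < lam)
    (p n : ℕ → ℝ) (hp : ∀ j ∈ Icc 1 k, 0 < p j)
    (hpmono : ∀ j ∈ Icc 1 (k - 1), p (j + 1) ≤ p j)
    (hn : ∀ j ∈ Icc 1 k, 0 ≤ n j)
    (tstar : ℕ → ℝ)
    (htk : tstar k = 1 / ((k : ℝ) - ∑ j ∈ Icc 1 (k - 1), p (j + 1) / p j))
    (htj : ∀ j ∈ Icc 1 (k - 1), tstar j = (1 - p (j + 1) / p j) * tstar k) :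
    (∑ j ∈ Icc 1 k, n j * p j * (1 - Real.exp (-lam)))
          / ((k : ℝ) - ∑ j ∈ Icc 1 (k - 1), p (j + 1) / p j)
        ≤ ∑ l ∈ Icc 1 k, n l *
            ∑ j ∈ Icc l k, p j * Real.exp (-lam * ∑ i ∈ Icc l (j - 1), tstar i)
              * (1 - Real.exp (-lam * tstar j))
    ∧ (∑ j ∈ Icc 1 k, n j * p j * (1 - Real.exp (-lam))) / (k : ℝ)
        ≤ (∑ j ∈ Icc 1 k, n j * p j * (1 - Real.exp (-lam)))
            / ((k : ℝ) - ∑ j ∈ Icc 1 (k - 1), p (j + 1) / p j) := by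
  set D : ℝ := (k : ℝ) - ∑ j ∈ Icc 1 (k - 1), p (j + 1) / p j with hD
  have hmem : ∀ j ∈ Icc 1 (k - 1), j ∈ Icc 1 k := fun j hj =>
    Icc_subset_Icc_right (Nat.sub_le k 1) hj
  have hIcc : ∀ l j, 1 ≤ j → Icc l (j - 1) = Ico l j := fun l j hj => by
    ext i
    simp only [mem_Icc, mem_Ico]
    omega
  have hratio_le : ∀ j ∈ Icc 1 (k - 1), p (j + 1) / p j ≤ 1 := fun j hj =>
    (div_le_one (hp j (hmem j hj))).2 (hpmono j hj)
  have hratio_nonneg : ∀ j ∈ Icc 1 (k - 1), 0 ≤ p (j + 1) / p j := fun j hj => by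
    refine div_nonneg (hp _ ?_).le (hp j (hmem j hj)).le
    simp only [mem_Icc] at hj ⊢
    omega
  have hcard : ∑ j ∈ Icc 1 (k - 1), (1 : ℝ) = k - 1 := by
    simp [Nat.cast_sub hk]
  have hD1 : 1 ≤ D := by linarith [sum_le_sum hratio_le]
  have hDk : D ≤ k := by linarith [sum_nonneg hratio_nonneg]
  have hDpos : 0 < D := by linarith
  have hexp : 0 ≤ 1 - Real.exp (-lam) := by
    linarith [Real.exp_le_one_iff.2 (neg_nonpos.2 hlam.le)]
  have hc0 : 0 ≤ tstar k := htk ▸ (one_div_pos.2 hDpos).le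
  have ht0 : ∀ j ∈ Ico 1 k, 0 ≤ tstar j := fun j hj => by
    rw [← hIcc 1 k hk] at hj
    rw [htj j hj]
    exact mul_nonneg (sub_nonneg.2 (hratio_le j hj)) hc0
  have htotal : ∑ j ∈ Ico 1 k, tstar j + tstar k = 1 := by
    rw [← hIcc 1 k hk, sum_congr rfl htj, ← sum_mul, sum_sub_distrib, hcard, htk]
    field_simp
    linarith
  refine ⟨?_, div_le_div_of_nonneg_left (sum_nonneg fun j hj =>
    mul_nonneg (mul_nonneg (hn j hj) (hp j hj).le) hexp) hDpos hDk⟩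
  rw [sum_div]
  refine sum_le_sum fun l hl => ?_
  obtain ⟨hl1, hlk⟩ := mem_Icc.1 hl
  have hsub : ∀ j ∈ Ico l k, j ∈ Ico 1 k := fun j hj => Ico_subset_Ico_left hl1 hj
  have hpart : ∑ j ∈ Ico l k, tstar j + tstar k ≤ 1 := by
    linarith [sum_le_sum_of_subset_of_nonneg (Ico_subset_Ico_left hl1)
      fun j hj _ => ht0 j hj]
  have hrev := le_sum_Ico_revenue lam (tstar k) p tstar hlk
    (fun j hj => hpmono j (hIcc 1 k hk ▸ hsub j hj))
    (fun j hj => by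
      have hj' : j ∈ Icc 1 (k - 1) := hIcc 1 k hk ▸ hsub j hj
      have := (hp j (hmem j hj')).ne'
      rw [htj j hj']
      field_simp)
    (fun j hj => ht0 j (hsub j hj)) (by linarith)
  have hchord := mul_le_mul_of_nonneg_left
    (mul_one_sub_exp_neg_le lam
      (add_nonneg (sum_nonneg fun j hj => ht0 j (hsub j hj)) hc0) hpart)
    (hp k (mem_Icc.2 ⟨hk, le_rfl⟩)).le
  rw [mul_add (-lam), Real.exp_add] at hchord
  calc n l * p l * (1 - Real.exp (-lam)) / D
      = n l * (p l * tstar k * (1 - Real.exp (-lam))) := by rw [htk]; ring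
    _ ≤ _ := mul_le_mul_of_nonneg_left ?_ (hn l hl)
  rw [show Icc l k = Ico l (k + 1) from hIcc l (k + 1) k.succ_pos, sum_Ico_succ_top hlk,
    hIcc l k hk, sum_congr rfl fun j hj => by
      rw [hIcc l j (hl1.trans (mem_Ico.1 hj).1)]]
  linear_combination hrev + hchord
end

section
/- Let p_1 ≥ p_2 ≥ ⋯ ≥ p_k > 0. Then for every t ∈ ℝ^k with t_j ≥ 0 for all j and Σ_{j=1}^k t_j = 1, min_{i∈{1,…,k}} (Σ_{j=i}^k p_j t_j)/p_i ≤ 1/(k − Σ_{j=1}^{k−1} p_{j+1}/p_j). -/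
open Finset

/-- Summation by parts for the tail sums `S i = ∑ j ≥ i, p j * t j`: lower bounds `m * p i ≤ S i`
on the tails give a lower bound on the partial sums of `t`. -/
theorem mul_sub_sum_ratio_le_sum_add_tail_div {p t S : ℕ → ℝ} {m : ℝ} (n : ℕ)
    (hp : ∀ j ∈ Icc 1 (n + 1), 0 < p j) (hpmono : ∀ j ∈ Icc 1 n, p (j + 1) ≤ p j)
    (hS : ∀ j ∈ Icc 1 n, S j = p j * t j + S (j + 1))
    (hm : ∀ j ∈ Icc 1 (n + 1), m * p j ≤ S j) :
    m * ((n + 1 : ℝ) - ∑ j ∈ Icc 1 n, p (j + 1) / p j)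
      ≤ ∑ j ∈ Icc 1 n, t j + S (n + 1) / p (n + 1) := by
  induction n with
  | zero =>
    simpa using (le_div_iff₀ (hp 1 (by simp))).2 (hm 1 (by simp))
  | succ n ih =>
    have IH := ih (fun j hj => hp j (by simp at hj ⊢; omega))
      (fun j hj => hpmono j (by simp at hj ⊢; omega))
      (fun j hj => hS j (by simp at hj ⊢; omega))
      (fun j hj => hm j (by simp at hj ⊢; omega))
    have hpos : 0 < p (n + 1) := hp _ (by simp)
    have hpos' : 0 < p (n + 1 + 1) := hp _ (by simp)
    have hinv : 0 ≤ 1 / p (n + 1 + 1) - 1 / p (n + 1) :=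
      sub_nonneg.2 (one_div_le_one_div_of_le hpos' (hpmono _ (by simp)))
    have hstep := mul_le_mul_of_nonneg_right (hm (n + 1 + 1) (by simp)) hinv
    have hleft : m * p (n + 1 + 1) * (1 / p (n + 1 + 1) - 1 / p (n + 1))
        = m * (1 - p (n + 1 + 1) / p (n + 1)) := by
      field_simp
    have hright : S (n + 1 + 1) * (1 / p (n + 1 + 1) - 1 / p (n + 1))
        = t (n + 1) + S (n + 1 + 1) / p (n + 1 + 1) - S (n + 1) / p (n + 1) := by
      rw [hS (n + 1) (by simp)]
      field_simp
      ring
    rw [hleft, hright] at hstep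
    rw [sum_Icc_succ_top (by omega), sum_Icc_succ_top (by omega)]
    push_cast
    linarith

/-- Optimality of the robust policy for the max-min LP (P2): for every policy
`t` in the probability simplex, the worst-case ratio
`min_{i∈[k]} (Σ_{j=i}^k p_j t_j)/p_i` is at most `1/(k − Σ_{j<k} p_{j+1}/p_j)`. -/
theorem maxmin_lp_upper_bound (k : ℕ) (hk : 1 ≤ k)
    (p : ℕ → ℝ) (hp : ∀ j ∈ Icc 1 k, 0 < p j)
    (hpmono : ∀ j ∈ Icc 1 (k - 1), p (j + 1) ≤ p j)
    (t : ℕ → ℝ) (ht0 : ∀ j ∈ Icc 1 k, 0 ≤ t j) (ht1 : ∑ j ∈ Icc 1 k, t j = 1) :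
    (Icc 1 k).inf' (Finset.nonempty_Icc.mpr hk)
        (fun i => (∑ j ∈ Icc i k, p j * t j) / p i)
      ≤ 1 / ((k : ℝ) - ∑ j ∈ Icc 1 (k - 1), p (j + 1) / p j) := by
  obtain ⟨n, rfl⟩ : ∃ n, k = n + 1 := ⟨k - 1, by omega⟩
  simp only [Nat.add_sub_cancel] at hpmono ⊢
  have hratio : ∑ j ∈ Icc 1 n, p (j + 1) / p j ≤ n := by
    calc ∑ j ∈ Icc 1 n, p (j + 1) / p j ≤ ∑ j ∈ Icc 1 n, (1 : ℝ) :=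
          sum_le_sum fun j hj => div_le_one_of_le₀ (hpmono j hj)
            (hp j (by simp at hj ⊢; omega)).le
      _ = n := by simp
  rw [le_div_iff₀ (by push_cast; linarith)]
  have key := mul_sub_sum_ratio_le_sum_add_tail_div (t := t)
    (m := (Icc 1 (n + 1)).inf' (nonempty_Icc.mpr hk)
      fun i => (∑ j ∈ Icc i (n + 1), p j * t j) / p i)
    (S := fun i => ∑ j ∈ Icc i (n + 1), p j * t j) n hp hpmono
    (fun j hj => by
      have hle : j ≤ n + 1 := by simp at hj; omega
      simp only [Icc_add_one_left_eq_Ioc, add_sum_Ioc_eq_sum_Icc hle (f := fun j => p j * t j)])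
    (fun j hj => (le_div_iff₀ (hp j hj)).1 (inf'_le
      (fun i => (∑ j ∈ Icc i (n + 1), p j * t j) / p i) hj))
  have hlast : p (n + 1) ≠ 0 := (hp _ (by simp)).ne'
  rw [sum_Icc_succ_top (by omega)] at ht1
  simp only [Icc_self, sum_singleton, mul_div_cancel_left₀ _ hlast, ht1] at key
  exact_mod_cast key
end

section
/- For every integer k ≥ 1 and every real ε > 0, there exist prices p_1 > p_2 > ⋯ > p_k > 0 such that 1/(k − Σ_{j=1}^{k−1} p_{j+1}/p_j) ≤ 1/k + ε; consequently, for these prices, every t ∈ ℝ^k with t_j ≥ 0 and Σ_{j=1}^k t_j = 1 satisfies min_{i∈{1,…,k}} (Σ_{j=i}^k p_j t_j)/p_i ≤ 1/k + ε. -/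
open Finset

/-- Summation by parts for the geometric prices `r ^ j`. -/
lemma sum_geometric_price_tails (r : ℝ) (hr : r ≠ 0) (k : ℕ) (t : ℕ → ℝ) :
    ∑ j ∈ Icc 1 k, t j =
      (1 - r) * ∑ i ∈ Icc 1 k, (∑ j ∈ Icc i k, r ^ j * t j) / r ^ i
        + r * ((∑ j ∈ Icc 1 k, r ^ j * t j) / r ^ 1) := by
  set R : ℕ → ℝ := fun i => (∑ j ∈ Icc i k, r ^ j * t j) / r ^ i with hR
  have hstep : ∀ i ∈ Icc 1 k, t i = R i - r * R (i + 1) := by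
    intro i hi
    have hsum : ∑ j ∈ Icc i k, r ^ j * t j =
        r ^ i * t i + ∑ j ∈ Icc (i + 1) k, r ^ j * t j := by
      rw [← Finset.insert_Icc_add_one_left_eq_Icc (mem_Icc.mp hi).2,
        sum_insert (by simp)]
    simp only [hR, hsum]
    field_simp
    ring
  have hlast : R (k + 1) = 0 := by simp [hR]
  have hshift : ∑ i ∈ Icc 1 k, (R (i + 1) - R i) = R (k + 1) - R 1 := by
    rw [← Finset.Ico_add_one_right_eq_Icc]
    exact Finset.sum_Ico_sub R (by omega)
  rw [sum_sub_distrib, hlast] at hshift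
  rw [sum_congr rfl hstep, sum_sub_distrib, ← mul_sum]
  change _ = (1 - r) * ∑ i ∈ Icc 1 k, R i + r * R 1
  linear_combination (-r) * hshift

/-- Core construction for Theorem 2 (upper bound on the competitive ratio):
for every `k ≥ 1` and `ε > 0` there are strictly decreasing positive prices
with `1/(k − Σ_{j<k} p_{j+1}/p_j) ≤ 1/k + ε`, so that every policy in the
probability simplex has worst-case ratio at most `1/k + ε`. -/
theorem cr_upper_bound_construction (k : ℕ) (hk : 1 ≤ k) (ε : ℝ) (hε : 0 < ε) :
    ∃ p : ℕ → ℝ,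
      (∀ j ∈ Icc 1 k, 0 < p j)
      ∧ (∀ j ∈ Icc 1 (k - 1), p (j + 1) < p j)
      ∧ 1 / ((k : ℝ) - ∑ j ∈ Icc 1 (k - 1), p (j + 1) / p j) ≤ 1 / k + ε
      ∧ ∀ t : ℕ → ℝ, (∀ j ∈ Icc 1 k, 0 ≤ t j) → (∑ j ∈ Icc 1 k, t j = 1) →
          (Icc 1 k).inf' (Finset.nonempty_Icc.mpr hk)
              (fun i => (∑ j ∈ Icc i k, p j * t j) / p i)
            ≤ 1 / k + ε := by
  have hk0 : (0 : ℝ) < k := by exact_mod_cast hk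
  have hkε : 0 < (k : ℝ) * ε := mul_pos hk0 hε
  obtain ⟨r, hr0, hr1, hrc⟩ :
      ∃ r : ℝ, 0 < r ∧ r < 1 ∧ (1 / (k : ℝ) + ε) * (k * (1 - r)) = 1 := by
    refine ⟨k * ε / (1 + k * ε), by positivity, ?_, ?_⟩
    · rw [div_lt_one (by positivity)]
      linarith
    · field_simp
      ring
  have hc : 0 < 1 / (k : ℝ) + ε := by positivity
  refine ⟨fun j => r ^ j, fun j _ => pow_pos hr0 j,
    fun j _ => pow_lt_pow_right_of_lt_one₀ hr0 hr1 (Nat.lt_succ_self j), ?_, ?_⟩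
  · have hsum : ∑ j ∈ Icc 1 (k - 1), r ^ (j + 1) / r ^ j = ((k : ℝ) - 1) * r := by
      have hratio : ∀ j ∈ Icc 1 (k - 1), r ^ (j + 1) / r ^ j = r := by
        intro j _
        rw [pow_succ]
        field_simp
      rw [sum_congr rfl hratio, sum_const, Nat.card_Icc, nsmul_eq_mul]
      push_cast [Nat.sub_add_cancel hk, Nat.cast_sub hk]
      simp
    change 1 / ((k : ℝ) - ∑ j ∈ Icc 1 (k - 1), r ^ (j + 1) / r ^ j) ≤ _
    have hpos : 0 < (k : ℝ) - (k - 1) * r := by nlinarith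
    rw [hsum, div_le_iff₀ hpos]
    nlinarith [mul_pos hc hr0]
  · intro t _ ht1
    by_contra! hlt
    rw [Finset.lt_inf'_iff] at hlt
    have hident := sum_geometric_price_tails r hr0.ne' k t
    rw [ht1] at hident
    have htails := card_nsmul_le_sum (Icc 1 k) _ _ fun i hi => (hlt i hi).le
    rw [Nat.card_Icc, Nat.add_sub_cancel, nsmul_eq_mul] at htails
    have hfirst := hlt 1 (mem_Icc.mpr ⟨le_rfl, hk⟩)
    have h1 := mul_le_mul_of_nonneg_left htails (sub_nonneg.mpr hr1.le)
    have h2 := mul_pos hr0 (hc.trans hfirst)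
    linarith
end

section
/- Let u = (1/k, 1/k, …, 1/k) ∈ ℝ^k be the naive deterministic policy that spends time 1/k at each price. Then Rev(u) ≥ UB/k. -/
open Finset

/-- Spending a `1/k` fraction of the time keeps at least a `1/k` fraction of the
exponential selling probability. -/
theorem one_sub_exp_neg_div_le {k : ℕ} (hk : 1 ≤ k) (x : ℝ) :
    (1 - Real.exp (-x)) / k ≤ 1 - Real.exp (-x * (1 / k)) := by
  have hk0 : (0 : ℝ) < k := by exact_mod_cast hk
  have hpow : Real.exp (-x * (1 / k)) ^ k = Real.exp (-x) := by
    rw [← Real.exp_nat_mul]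
    congr 1
    field_simp
  have hbern := one_add_mul_le_pow (a := Real.exp (-x * (1 / k)) - 1)
    (by linarith [Real.exp_pos (-x * (1 / k))]) k
  rw [add_sub_cancel, hpow] at hbern
  rw [div_le_iff₀ hk0]
  linarith

/-- Proposition 4: the naive deterministic policy `u = (1/k, …, 1/k)` is
`1/k`-competitive, i.e. `Rev(u) ≥ UB/k`. -/
theorem naive_deterministic_competitive (k : ℕ) (hk : 1 ≤ k)
    (lam : ℝ) (hlam : 0 < lam)
    (p n : ℕ → ℝ) (hp : ∀ j ∈ Icc 1 k, 0 < p j)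
    (hpmono : ∀ j ∈ Icc 1 (k - 1), p (j + 1) ≤ p j)
    (hn : ∀ j ∈ Icc 1 k, 0 ≤ n j) :
    (∑ j ∈ Icc 1 k, n j * p j * (1 - Real.exp (-lam))) / (k : ℝ)
      ≤ ∑ l ∈ Icc 1 k, n l *
          ∑ j ∈ Icc l k,
            p j * Real.exp (-lam * ∑ i ∈ Icc l (j - 1), (1 : ℝ) / k)
              * (1 - Real.exp (-lam * ((1 : ℝ) / k))) := by
  rw [sum_div]
  refine sum_le_sum fun l hl => ?_
  obtain ⟨hl1, hlk⟩ := mem_Icc.mp hl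
  have hexp : 0 ≤ 1 - Real.exp (-lam * ((1 : ℝ) / k)) :=
    sub_nonneg.mpr (Real.exp_le_one_iff.mpr
      (mul_nonpos_of_nonpos_of_nonneg (neg_nonpos.mpr hlam.le) (by positivity)))
  rw [mul_assoc, mul_div_assoc, mul_div_assoc]
  refine mul_le_mul_of_nonneg_left ?_ (hn l hl)
  calc p l * ((1 - Real.exp (-lam)) / k)
      ≤ p l * (1 - Real.exp (-lam * ((1 : ℝ) / k))) :=
        mul_le_mul_of_nonneg_left (one_sub_exp_neg_div_le hk lam) (hp l hl).le
    _ = p l * Real.exp (-lam * ∑ i ∈ Icc l (l - 1), (1 : ℝ) / k)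
          * (1 - Real.exp (-lam * ((1 : ℝ) / k))) := by
        rw [Icc_eq_empty (by omega), sum_empty, mul_zero, Real.exp_zero, mul_one]
    _ ≤ _ := single_le_sum
        (f := fun j => p j * Real.exp (-lam * ∑ i ∈ Icc l (j - 1), (1 : ℝ) / k)
          * (1 - Real.exp (-lam * ((1 : ℝ) / k))))
        (fun j hj => mul_nonneg (mul_nonneg
          (hp j (mem_Icc.mpr ⟨hl1.trans (mem_Icc.mp hj).1, (mem_Icc.mp hj).2⟩)).le
          (Real.exp_pos _).le) hexp)
        (mem_Icc.mpr ⟨le_rfl, hlk⟩)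
end

section
/- Let (Δ_j)_{j=1}^k be self-neutralizing and conditionally sub-gaussian with constants c_1, …, c_k ≥ 0. Then for every γ > 0 and every non-increasing sequence of nonnegative reals r_1 ≥ r_2 ≥ ⋯ ≥ r_k ≥ 0, E[exp(γ Σ_{j=1}^k r_j Δ_j)] ≤ exp((γ²/2) Σ_{j=1}^k (r_j c_j)²). -/
open Finset MeasureTheory

/-- Finite sums of functions with exponential moments of all orders have exponential moments of
all orders. -/
theorem integrable_exp_mul_sum {Ω ι : Type*} [MeasurableSpace Ω] {P : Measure Ω}
    [IsFiniteMeasure P] {X : ι → Ω → ℝ} (s : Finset ι) (hX : ∀ i ∈ s, AEMeasurable (X i) P)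
    (hexp : ∀ i ∈ s, ∀ t : ℝ, Integrable (fun ω => Real.exp (t * X i ω)) P) (t : ℝ) :
    Integrable (fun ω => Real.exp (t * ∑ i ∈ s, X i ω)) P := by
  classical
  induction s using Finset.induction_on generalizing t with
  | empty => simp
  | insert a s ha ih =>
    have hs := ih (fun i hi => hX i (mem_insert_of_mem hi))
      (fun i hi => hexp i (mem_insert_of_mem hi)) (2 * t)
    have hmeas : AEMeasurable (fun ω => ∑ i ∈ insert a s, X i ω) P :=
      Finset.aemeasurable_fun_sum _ hX
    refine ((hexp a (mem_insert_self a s) (2 * t)).add hs).mono'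
      (hmeas.const_mul t).exp.aestronglyMeasurable (ae_of_all _ fun ω => ?_)
    rw [Real.norm_eq_abs, Real.abs_exp, sum_insert ha, mul_add, Real.exp_add, Pi.add_apply,
      mul_assoc, mul_assoc, two_mul, two_mul, Real.exp_add, Real.exp_add]
    nlinarith [sq_nonneg (Real.exp (t * X a ω) - Real.exp (t * ∑ i ∈ s, X i ω)),
      Real.exp_pos (t * X a ω), Real.exp_pos (t * ∑ i ∈ s, X i ω)]

/-- If `∫ f * g` is taken with `f` nonnegative and measurable with respect to `m`, then `g` may be
replaced by any upper bound of its conditional expectation given `m`. -/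
theorem integral_mul_le_of_condExp_le {Ω : Type*} {m m0 : MeasurableSpace Ω} {P : Measure Ω}
    [IsFiniteMeasure P] (hm : m ≤ m0) {f g h : Ω → ℝ} (hf : StronglyMeasurable[m] f)
    (hf0 : 0 ≤ f) (hg : Integrable g P) (hfg : Integrable (f * g) P) (hfh : Integrable (f * h) P)
    (hgh : P[g|m] ≤ᵐ[P] h) :
    ∫ ω, (f * g) ω ∂P ≤ ∫ ω, (f * h) ω ∂P := by
  rw [← integral_condExp hm]
  refine integral_mono_ae integrable_condExp hfh ?_
  filter_upwards [condExp_mul_of_stronglyMeasurable_left hf hfg hg, hgh] with ω h1 h2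
  rw [h1]
  exact mul_le_mul_of_nonneg_left h2 (hf0 ω)

/-- Theorem 7 (MGF bound): if `(Δ_j)_{j=1}^k` is self-neutralizing and
conditionally sub-gaussian with constants `c_j`, then for every `γ > 0` and
every non-increasing nonnegative sequence `r`,
`E[exp(γ Σ_j r_j Δ_j)] ≤ exp((γ²/2) Σ_j (r_j c_j)²)`. -/
theorem mgf_bound {Ω : Type*} [m0 : MeasurableSpace Ω]
    (P : Measure Ω) [IsProbabilityMeasure P]
    (k : ℕ) (hk : 1 ≤ k)
    (𝒜 : ℕ → MeasurableSpace Ω) (h𝒜mono : Monotone 𝒜) (h𝒜le : ∀ j, 𝒜 j ≤ m0)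
    (Δ : ℕ → Ω → ℝ)
    (hmeas : ∀ j ∈ Icc 1 k, Measurable[𝒜 j] (Δ j))
    (hint : ∀ j ∈ Icc 1 k, Integrable (Δ j) P)
    (c : ℕ → ℝ) (hc : ∀ j ∈ Icc 1 k, 0 ≤ c j)
    -- self-neutralizing
    (hSN : ∀ j ∈ Icc 1 k,
      P[Δ j|𝒜 (j - 1)] =ᵐ[P] fun ω => -∑ i ∈ Icc 1 (j - 1), Δ i ω)
    -- conditionally sub-gaussian
    (hSG : ∀ j ∈ Icc 1 k, ∀ γ : ℝ,
      Integrable (fun ω => Real.exp (γ * Δ j ω)) P ∧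
      (P[fun ω => Real.exp (γ * Δ j ω)|𝒜 (j - 1)]) ≤ᵐ[P]
        fun ω => Real.exp (γ * (P[Δ j|𝒜 (j - 1)]) ω + γ ^ 2 * c j ^ 2 / 2))
    (r : ℕ → ℝ) (hr0 : ∀ j ∈ Icc 1 k, 0 ≤ r j)
    (hrmono : ∀ j ∈ Icc 1 (k - 1), r (j + 1) ≤ r j)
    -- integrability of the weighted partial sums
    (hintexp : ∀ j ∈ Icc 1 k, ∀ γ : ℝ,
      Integrable (fun ω => Real.exp (γ * ∑ i ∈ Icc 1 j, r i * Δ i ω)) P)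
    (γ : ℝ) (hγ : 0 < γ) :
    ∫ ω, Real.exp (γ * ∑ j ∈ Icc 1 k, r j * Δ j ω) ∂P
      ≤ Real.exp (γ ^ 2 / 2 * ∑ j ∈ Icc 1 k, (r j * c j) ^ 2) := by
  have hΔ : ∀ i ∈ Icc 1 k, Measurable (Δ i) := fun i hi => (hmeas i hi).mono (h𝒜le i) le_rfl
  have hexp : ∀ n ≤ k, ∀ (a : ℕ → ℝ) (t : ℝ),
      Integrable (fun ω => Real.exp (t * ∑ i ∈ Icc 1 n, a i * Δ i ω)) P := by
    intro n hn a t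
    have hsub : Icc 1 n ⊆ Icc 1 k := Icc_subset_Icc_right hn
    refine integrable_exp_mul_sum (X := fun i ω => a i * Δ i ω) _
      (fun i hi => ((hΔ i (hsub hi)).const_mul (a i)).aemeasurable) (fun i hi s => ?_) t
    simpa only [mul_assoc] using (hSG i (hsub hi) (s * a i)).1
  have key : ∀ n ≤ k, ∀ a : ℕ → ℝ, (∀ j ∈ Icc 1 n, 0 ≤ a j) → AntitoneOn a (Icc 1 n) →
      ∫ ω, Real.exp (γ * ∑ j ∈ Icc 1 n, a j * Δ j ω) ∂P
        ≤ Real.exp (γ ^ 2 / 2 * ∑ j ∈ Icc 1 n, (a j * c j) ^ 2) := by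
    intro n
    induction n with
    | zero => intro _ a _ _; simp
    | succ n ih =>
      intro hn a ha0 ha
      have hnk : n ≤ k := by lia
      have hmem : n + 1 ∈ Icc 1 k := by simp; lia
      have hlast : n + 1 ∈ Icc 1 (n + 1) := by simp
      have hsub : Icc 1 n ⊆ Icc 1 (n + 1) := Icc_subset_Icc_right n.le_succ
      have hle : ∀ j ∈ Icc 1 n, a (n + 1) ≤ a j := fun j hj =>
        ha (mod_cast hsub hj) (mod_cast hlast) (by simp at hj; lia)
      set b : ℕ → ℝ := fun j => a j - a (n + 1) with hb
      set C : ℝ := γ ^ 2 / 2 * (a (n + 1) * c (n + 1)) ^ 2 with hC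
      set f : Ω → ℝ := fun ω => Real.exp (γ * ∑ j ∈ Icc 1 n, a j * Δ j ω) with hf
      set g : Ω → ℝ := fun ω => Real.exp (γ * a (n + 1) * Δ (n + 1) ω) with hg
      set h : Ω → ℝ := fun ω => Real.exp (-(γ * a (n + 1) * ∑ i ∈ Icc 1 n, Δ i ω) + C) with hh
      have hfg : (fun ω => Real.exp (γ * ∑ j ∈ Icc 1 (n + 1), a j * Δ j ω)) = f * g := by
        ext ω
        rw [Pi.mul_apply, hf, hg, ← Real.exp_add, sum_Icc_succ_top (by lia)]
        ring_nf
      have hfh : f * h =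
          fun ω => Real.exp C * Real.exp (γ * ∑ j ∈ Icc 1 n, b j * Δ j ω) := by
        ext ω
        rw [Pi.mul_apply, hf, hh, ← Real.exp_add, ← Real.exp_add]
        simp only [hb, sub_mul, sum_sub_distrib, ← mul_sum]
        ring_nf
      have hfmeas : Measurable[𝒜 n] f := by
        refine Real.measurable_exp.comp (Measurable.const_mul ?_ γ)
        refine Finset.measurable_fun_sum _ fun i hi => Measurable.const_mul ?_ (a i)
        rw [mem_Icc] at hi
        exact (hmeas i (by simp; lia)).mono (h𝒜mono hi.2) le_rfl
      have hgh : P[g|𝒜 n] ≤ᵐ[P] h := by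
        have h1 := (hSG (n + 1) hmem (γ * a (n + 1))).2
        have h2 := hSN (n + 1) hmem
        simp only [Nat.add_sub_cancel] at h1 h2
        filter_upwards [h1, h2] with ω h1 h2
        refine h1.trans (le_of_eq ?_)
        rw [h2, hh, hC]
        ring_nf
      calc ∫ ω, Real.exp (γ * ∑ j ∈ Icc 1 (n + 1), a j * Δ j ω) ∂P
          = ∫ ω, (f * g) ω ∂P := by rw [← hfg]
        _ ≤ ∫ ω, (f * h) ω ∂P :=
            integral_mul_le_of_condExp_le (h𝒜le n) hfmeas.stronglyMeasurable
              (fun ω => (Real.exp_pos _).le) (hSG (n + 1) hmem (γ * a (n + 1))).1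
              (hfg ▸ hexp (n + 1) hn a γ) (hfh ▸ (hexp n hnk b γ).const_mul _) hgh
        _ = Real.exp C * ∫ ω, Real.exp (γ * ∑ j ∈ Icc 1 n, b j * Δ j ω) ∂P := by
            rw [hfh, integral_const_mul]
        _ ≤ Real.exp C * Real.exp (γ ^ 2 / 2 * ∑ j ∈ Icc 1 n, (b j * c j) ^ 2) := by
            gcongr
            exact ih hnk b (fun j hj => sub_nonneg.2 (hle j hj)) fun i hi j hj hij =>
              sub_le_sub_right (ha (mod_cast hsub (mod_cast hi)) (mod_cast hsub (mod_cast hj)) hij) _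
        _ ≤ Real.exp C * Real.exp (γ ^ 2 / 2 * ∑ j ∈ Icc 1 n, (a j * c j) ^ 2) := by
            gcongr with j hj
            · exact mul_nonneg (sub_nonneg.2 (hle j hj)) (hc j (Icc_subset_Icc_right hnk hj))
            · exact hc j (Icc_subset_Icc_right hnk hj)
            · exact sub_le_self _ (ha0 _ hlast)
        _ = Real.exp (γ ^ 2 / 2 * ∑ j ∈ Icc 1 (n + 1), (a j * c j) ^ 2) := by
            rw [← Real.exp_add, sum_Icc_succ_top (by lia), hC]
            ring_nf
  refine key k le_rfl r hr0 ?_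
  rw [coe_Icc]
  refine antitoneOn_of_add_one_le Set.ordConnected_Icc fun j _ hj hj' => hrmono j ?_
  simp only [Set.mem_Icc, mem_Icc] at hj hj' ⊢
  lia
end

section
/- Let (Δ_j)_{j=1}^k be self-neutralizing and conditionally sub-gaussian with constants c_1, …, c_k ≥ 0, and let r_1 ≥ r_2 ≥ ⋯ ≥ r_k ≥ 0 be a non-increasing sequence of nonnegative reals with Σ_{j=1}^k (r_j c_j)² > 0. Then for every τ > 0, P[Σ_{j=1}^k r_j Δ_j > τ] ≤ exp(−τ²/(2 Σ_{j=1}^k (r_j c_j)²)). -/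
open Finset MeasureTheory

/-- If all exponential moments of each `X i` are finite, so are those of linear combinations. -/
theorem integrable_exp_sum_mul {Ω ι : Type*} [MeasurableSpace Ω] {μ : Measure Ω}
    [IsFiniteMeasure μ] (s : Finset ι) (X : ι → Ω → ℝ)
    (hX : ∀ i ∈ s, ∀ t : ℝ, Integrable (fun ω => Real.exp (t * X i ω)) μ) (a : ι → ℝ) :
    Integrable (fun ω => Real.exp (∑ i ∈ s, a i * X i ω)) μ := by
  classical
  induction s using Finset.induction_on generalizing a with
  | empty => simp
  | insert i s hi ih =>
    have h₁ := hX i (mem_insert_self i s)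
    have h₂ := ih fun j hj => hX j (mem_insert_of_mem hj)
    have hprod : (fun ω => Real.exp (∑ j ∈ insert i s, a j * X j ω)) =
        fun ω => Real.exp (a i * X i ω) * Real.exp (∑ j ∈ s, a j * X j ω) := by
      funext ω
      rw [sum_insert hi, Real.exp_add]
    rw [hprod]
    refine ((h₁ (2 * a i)).add (h₂ fun j => 2 * a j)).mono'
      ((h₁ (a i)).aestronglyMeasurable.mul (h₂ a).aestronglyMeasurable) (ae_of_all _ fun ω => ?_)
    have e₁ : Real.exp (2 * a i * X i ω) = Real.exp (a i * X i ω) ^ 2 := by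
      rw [← Real.exp_nat_mul]; push_cast; ring_nf
    have e₂ : Real.exp (∑ j ∈ s, 2 * a j * X j ω) = Real.exp (∑ j ∈ s, a j * X j ω) ^ 2 := by
      rw [← Real.exp_nat_mul, mul_sum]; push_cast; simp only [mul_assoc]
    rw [Real.norm_of_nonneg (by positivity), Pi.add_apply, e₁, e₂]
    nlinarith [sq_nonneg (Real.exp (a i * X i ω) - Real.exp (∑ j ∈ s, a j * X j ω)),
      sq_nonneg (Real.exp (a i * X i ω)), sq_nonneg (Real.exp (∑ j ∈ s, a j * X j ω))]

/-- If `Y` is conditionally dominated by `Z` and `X ≥ 0` is measurable with respect to the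
conditioning σ-algebra, then `∫ X * Y ≤ ∫ X * Z`. -/
theorem integral_mul_le_integral_mul_of_condExp_le {Ω : Type*} {m m0 : MeasurableSpace Ω}
    {μ : Measure Ω} [IsFiniteMeasure μ] (hm : m ≤ m0) {X Y Z : Ω → ℝ}
    (hXm : StronglyMeasurable[m] X) (hX : ∀ ω, 0 ≤ X ω) (hY : Integrable Y μ)
    (hXY : Integrable (fun ω => X ω * Y ω) μ) (hXZ : Integrable (fun ω => X ω * Z ω) μ)
    (h : μ[Y|m] ≤ᵐ[μ] Z) :
    ∫ ω, X ω * Y ω ∂μ ≤ ∫ ω, X ω * Z ω ∂μ := by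
  rw [← integral_condExp hm]
  refine integral_mono_ae integrable_condExp hXZ ?_
  filter_upwards [condExp_mul_of_stronglyMeasurable_left hXm hXY hY, h] with ω h₁ h₂
  exact h₁.trans_le (mul_le_mul_of_nonneg_left h₂ (hX ω))

/-- Moment generating function bound for self-neutralizing conditionally sub-gaussian processes. -/
theorem integral_exp_sum_le_of_selfNeutralizing {Ω : Type*} [m0 : MeasurableSpace Ω]
    (P : Measure Ω) [IsProbabilityMeasure P]
    (k : ℕ) (𝒜 : ℕ → MeasurableSpace Ω) (h𝒜mono : Monotone 𝒜) (h𝒜le : ∀ j, 𝒜 j ≤ m0)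
    (Δ : ℕ → Ω → ℝ) (hmeas : ∀ j ∈ Icc 1 k, Measurable[𝒜 j] (Δ j)) (c : ℕ → ℝ)
    (hSN : ∀ j ∈ Icc 1 k,
      P[Δ j|𝒜 (j - 1)] =ᵐ[P] fun ω => -∑ i ∈ Icc 1 (j - 1), Δ i ω)
    (hSG : ∀ j ∈ Icc 1 k, ∀ γ : ℝ,
      Integrable (fun ω => Real.exp (γ * Δ j ω)) P ∧
      (P[fun ω => Real.exp (γ * Δ j ω)|𝒜 (j - 1)]) ≤ᵐ[P]
        fun ω => Real.exp (γ * (P[Δ j|𝒜 (j - 1)]) ω + γ ^ 2 * c j ^ 2 / 2))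
    (γ : ℝ) (r : ℕ → ℝ) (hr0 : ∀ j ∈ Icc 1 k, 0 ≤ r j) (hr : AntitoneOn r (Icc 1 k)) :
    ∫ ω, Real.exp (∑ i ∈ Icc 1 k, γ * r i * Δ i ω) ∂P
      ≤ Real.exp (γ ^ 2 / 2 * ∑ i ∈ Icc 1 k, (r i * c i) ^ 2) := by
  induction k generalizing r with
  | zero => simp
  | succ n ih =>
    have hsub : Icc 1 n ⊆ Icc 1 (n + 1) := Icc_subset_Icc_right n.le_succ
    have hlast : n + 1 ∈ Icc 1 (n + 1) := by simp
    have hI (a : ℕ → ℝ) := integrable_exp_sum_mul (Icc 1 n) Δ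
      (fun i hi t => (hSG i (hsub hi) t).1) a
    have hI' (a : ℕ → ℝ) := integrable_exp_sum_mul (Icc 1 (n + 1)) Δ
      (fun i hi t => (hSG i hi t).1) a
    have hdiff : ∀ i ∈ Icc 1 n, 0 ≤ r i - r (n + 1) := fun i hi =>
      sub_nonneg.2 (hr (hsub hi) hlast ((mem_Icc.1 (hsub hi)).2))
    have hmgf := ih (fun j hj => hmeas j (hsub hj)) (fun j hj => hSN j (hsub hj))
      (fun j hj => hSG j (hsub hj)) (fun i => r i - r (n + 1)) hdiff
      (fun i hi j hj hij => sub_le_sub_right (hr (hsub hi) (hsub hj) hij) _)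
    set C := (γ * r (n + 1)) ^ 2 * c (n + 1) ^ 2 / 2 with hC
    obtain ⟨hY, hcond⟩ := hSG (n + 1) hlast (γ * r (n + 1))
    have hN := hSN (n + 1) hlast
    simp only [Nat.add_sub_cancel] at hcond hN
    have hsplit (ω : Ω) : Real.exp (∑ i ∈ Icc 1 (n + 1), γ * r i * Δ i ω) =
        Real.exp (∑ i ∈ Icc 1 n, γ * r i * Δ i ω) * Real.exp (γ * r (n + 1) * Δ (n + 1) ω) := by
      rw [sum_Icc_succ_top (by omega), Real.exp_add]
    have hdom (ω : Ω) : Real.exp (∑ i ∈ Icc 1 n, γ * r i * Δ i ω) *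
        Real.exp (γ * r (n + 1) * (-∑ i ∈ Icc 1 n, Δ i ω) + C) =
        Real.exp (∑ i ∈ Icc 1 n, γ * (r i - r (n + 1)) * Δ i ω) * Real.exp C := by
      rw [← Real.exp_add, ← Real.exp_add, ← add_assoc, mul_neg, ← sub_eq_add_neg, mul_sum,
        ← sum_sub_distrib]
      congr 3 with i
      ring
    have hXm : StronglyMeasurable[𝒜 n] fun ω => Real.exp (∑ i ∈ Icc 1 n, γ * r i * Δ i ω) := by
      refine (Real.measurable_exp.comp (Finset.measurable_sum _ fun i hi => ?_)).stronglyMeasurable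
      exact ((hmeas i (hsub hi)).mono (h𝒜mono (mem_Icc.1 hi).2) le_rfl).const_mul _
    calc ∫ ω, Real.exp (∑ i ∈ Icc 1 (n + 1), γ * r i * Δ i ω) ∂P
        = ∫ ω, Real.exp (∑ i ∈ Icc 1 n, γ * r i * Δ i ω) *
            Real.exp (γ * r (n + 1) * Δ (n + 1) ω) ∂P := by simp only [hsplit]
      _ ≤ ∫ ω, Real.exp (∑ i ∈ Icc 1 n, γ * r i * Δ i ω) *
            Real.exp (γ * r (n + 1) * (-∑ i ∈ Icc 1 n, Δ i ω) + C) ∂P := by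
          refine integral_mul_le_integral_mul_of_condExp_le (h𝒜le n) hXm
            (fun ω => (Real.exp_pos _).le) hY ?_ ?_ ?_
          · simpa only [hsplit] using hI' fun i => γ * r i
          · simpa only [hdom] using (hI fun i => γ * (r i - r (n + 1))).mul_const (Real.exp C)
          · filter_upwards [hcond, hN] with ω h₁ h₂
            rwa [h₂] at h₁
      _ = (∫ ω, Real.exp (∑ i ∈ Icc 1 n, γ * (r i - r (n + 1)) * Δ i ω) ∂P) * Real.exp C := by
          simp only [hdom, integral_mul_const]
      _ ≤ Real.exp (γ ^ 2 / 2 * ∑ i ∈ Icc 1 n, (r i * c i) ^ 2) * Real.exp C := by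
          refine mul_le_mul_of_nonneg_right (hmgf.trans (Real.exp_le_exp.2 ?_)) (Real.exp_pos _).le
          refine mul_le_mul_of_nonneg_left (sum_le_sum fun i hi => ?_) (by positivity)
          rw [mul_pow, mul_pow]
          refine mul_le_mul_of_nonneg_right (pow_le_pow_left₀ (hdiff i hi) ?_ 2) (sq_nonneg _)
          exact sub_le_self _ (hr0 _ hlast)
      _ = Real.exp (γ ^ 2 / 2 * ∑ i ∈ Icc 1 (n + 1), (r i * c i) ^ 2) := by
          rw [← Real.exp_add, sum_Icc_succ_top (by omega), hC]
          ring_nf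

/-- Cramér–Chernoff tail bound for self-neutralizing conditionally sub-gaussian
processes: `P[Σ_j r_j Δ_j > τ] ≤ exp(−τ²/(2 Σ_j (r_j c_j)²))`. -/
theorem chernoff_tail_bound {Ω : Type*} [m0 : MeasurableSpace Ω]
    (P : Measure Ω) [IsProbabilityMeasure P]
    (k : ℕ) (hk : 1 ≤ k)
    (𝒜 : ℕ → MeasurableSpace Ω) (h𝒜mono : Monotone 𝒜) (h𝒜le : ∀ j, 𝒜 j ≤ m0)
    (Δ : ℕ → Ω → ℝ)
    (hmeas : ∀ j ∈ Icc 1 k, Measurable[𝒜 j] (Δ j))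
    (hint : ∀ j ∈ Icc 1 k, Integrable (Δ j) P)
    (c : ℕ → ℝ) (hc : ∀ j ∈ Icc 1 k, 0 ≤ c j)
    -- self-neutralizing
    (hSN : ∀ j ∈ Icc 1 k,
      P[Δ j|𝒜 (j - 1)] =ᵐ[P] fun ω => -∑ i ∈ Icc 1 (j - 1), Δ i ω)
    -- conditionally sub-gaussian
    (hSG : ∀ j ∈ Icc 1 k, ∀ γ : ℝ,
      Integrable (fun ω => Real.exp (γ * Δ j ω)) P ∧
      (P[fun ω => Real.exp (γ * Δ j ω)|𝒜 (j - 1)]) ≤ᵐ[P]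
        fun ω => Real.exp (γ * (P[Δ j|𝒜 (j - 1)]) ω + γ ^ 2 * c j ^ 2 / 2))
    (r : ℕ → ℝ) (hr0 : ∀ j ∈ Icc 1 k, 0 ≤ r j)
    (hrmono : ∀ j ∈ Icc 1 (k - 1), r (j + 1) ≤ r j)
    -- integrability of the weighted partial sums
    (hintexp : ∀ j ∈ Icc 1 k, ∀ γ : ℝ,
      Integrable (fun ω => Real.exp (γ * ∑ i ∈ Icc 1 j, r i * Δ i ω)) P)
    (hrc : 0 < ∑ j ∈ Icc 1 k, (r j * c j) ^ 2)
    (τ : ℝ) (hτ : 0 < τ) :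
    P {ω | τ < ∑ j ∈ Icc 1 k, r j * Δ j ω}
      ≤ ENNReal.ofReal
          (Real.exp (-τ ^ 2 / (2 * ∑ j ∈ Icc 1 k, (r j * c j) ^ 2))) := by
  set V := ∑ j ∈ Icc 1 k, (r j * c j) ^ 2 with hV
  have hr : AntitoneOn r (Icc 1 k) := by
    intro i hi j hj hij
    have hi := mem_Icc.1 (mem_coe.1 hi)
    have hj := mem_Icc.1 (mem_coe.1 hj)
    induction j, hij using Nat.le_induction with
    | base => exact le_rfl
    | succ j hij ih =>
      exact (hrmono j (mem_Icc.2 (by omega))).trans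
        (ih (by simp; omega) ⟨by omega, by omega⟩)
  have hmgf := integral_exp_sum_le_of_selfNeutralizing P k 𝒜 h𝒜mono h𝒜le Δ hmeas c hSN hSG
    (τ / V) r hr0 hr
  simp only [mul_assoc, ← mul_sum] at hmgf
  have hmarkov := ProbabilityTheory.measure_ge_le_exp_mul_mgf τ (div_pos hτ hrc).le
    (hintexp k (mem_Icc.2 ⟨hk, le_rfl⟩) (τ / V))
  refine (measure_mono fun ω (hω : τ < _) => hω.le).trans
    ((ENNReal.le_ofReal_iff_toReal_le (measure_ne_top _ _) (Real.exp_pos _).le).2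
      (hmarkov.trans ?_))
  refine (mul_le_mul_of_nonneg_left hmgf (Real.exp_pos _).le).trans_eq ?_
  rw [← Real.exp_add, ← hV]
  congr 1
  field_simp
  ring
end

section
/- Let (Δ_j)_{j=1}^k be self-neutralizing and conditionally sub-gaussian with constants c_1, …, c_k ≥ 0 with Σ_{j=1}^k c_j² > 0. Then for every τ > 0, the probability that there exists a non-increasing vector r ∈ ℝ^k with 1 ≥ r_1 ≥ r_2 ≥ ⋯ ≥ r_k ≥ 0 such that |Σ_{j=1}^k r_j Δ_j| > τ is at most 2(k+1)·exp(−τ²/(2 Σ_{j=1}^k c_j²)). -/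
open Finset MeasureTheory

/-- A weighted sum with non-increasing weights in `[0, 1]` is bounded by any common bound on the
absolute values of the unweighted partial sums. -/
lemma abs_sum_mul_le_of_abs_sum_le {k : ℕ} (hk : 1 ≤ k) {r d : ℕ → ℝ} {τ : ℝ}
    (hr : ∀ j ∈ Icc 1 k, 0 ≤ r j ∧ r j ≤ 1)
    (hanti : ∀ j ∈ Icc 1 (k - 1), r (j + 1) ≤ r j)
    (hd : ∀ j ∈ Icc 1 k, |∑ i ∈ Icc 1 j, d i| ≤ τ) :
    |∑ j ∈ Icc 1 k, r j * d j| ≤ τ := by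
  have hτ : 0 ≤ τ := (abs_nonneg _).trans (hd k (by simp [hk]))
  have key : ∀ n, 1 ≤ n → n ≤ k →
      |∑ j ∈ Icc 1 n, r j * d j - r n * ∑ j ∈ Icc 1 n, d j| ≤ (r 1 - r n) * τ := by
    intro n hn
    induction n, hn using Nat.le_induction with
    | base => simp
    | succ n hn ih =>
      intro hnk
      have hstep : r (n + 1) ≤ r n := hanti n (by simp; omega)
      have hprefix := hd n (by simp; omega)
      rw [sum_Icc_succ_top (by omega), sum_Icc_succ_top (by omega)]
      calc _ = |(∑ j ∈ Icc 1 n, r j * d j - r n * ∑ j ∈ Icc 1 n, d j)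
              + (r n - r (n + 1)) * ∑ j ∈ Icc 1 n, d j| := by congr 1; ring
        _ ≤ (r 1 - r n) * τ + (r n - r (n + 1)) * τ := by
          refine (abs_add_le _ _).trans (add_le_add (ih (by omega)) ?_)
          rw [abs_mul, abs_of_nonneg (sub_nonneg.2 hstep)]
          exact mul_le_mul_of_nonneg_left hprefix (sub_nonneg.2 hstep)
        _ = _ := by ring
  have hk0 := (hr k (by simp [hk])).1
  have h1 := (hr 1 (by simp [hk])).2
  calc |∑ j ∈ Icc 1 k, r j * d j|
      = |(∑ j ∈ Icc 1 k, r j * d j - r k * ∑ j ∈ Icc 1 k, d j)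
          + r k * ∑ j ∈ Icc 1 k, d j| := by congr 1; ring
    _ ≤ (r 1 - r k) * τ + r k * τ := by
      refine (abs_add_le _ _).trans (add_le_add (key k hk le_rfl) ?_)
      rw [abs_mul, abs_of_nonneg hk0]
      exact mul_le_mul_of_nonneg_left (hd k (by simp [hk])) hk0
    _ = r 1 * τ := by ring
    _ ≤ τ := mul_le_of_le_one_left hτ h1

/-- If `Y` is conditionally sub-gaussian given `m` with conditional mean `-X`, where `X` is
`m`-measurable, then the moment generating function of `X + Y` has the same sub-gaussian bound. -/
lemma integral_exp_mul_add_le {Ω : Type*} {m m0 : MeasurableSpace Ω} {P : Measure Ω}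
    [IsProbabilityMeasure P] (hm : m ≤ m0) {X Y : Ω → ℝ} {γ c : ℝ} (hX : Measurable[m] X)
    (hmean : P[Y|m] =ᵐ[P] fun ω => -X ω)
    (hY : Integrable (fun ω => Real.exp (γ * Y ω)) P)
    (hXY : Integrable (fun ω => Real.exp (γ * (X ω + Y ω))) P)
    (hsub : (P[fun ω => Real.exp (γ * Y ω)|m]) ≤ᵐ[P]
      fun ω => Real.exp (γ * (P[Y|m]) ω + γ ^ 2 * c ^ 2 / 2)) :
    ∫ ω, Real.exp (γ * (X ω + Y ω)) ∂P ≤ Real.exp (γ ^ 2 * c ^ 2 / 2) := by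
  have hprod : (fun ω => Real.exp (γ * (X ω + Y ω)))
      = (fun ω => Real.exp (γ * X ω)) * fun ω => Real.exp (γ * Y ω) := by
    ext ω
    simp [mul_add, Real.exp_add]
  have hexpX : StronglyMeasurable[m] fun ω => Real.exp (γ * X ω) :=
    (Real.measurable_exp.comp (hX.const_mul γ)).stronglyMeasurable
  have hpull := condExp_mul_of_stronglyMeasurable_left hexpX (hprod ▸ hXY) hY
  rw [← hprod] at hpull
  rw [← integral_condExp hm]
  calc _ ≤ ∫ _, Real.exp (γ ^ 2 * c ^ 2 / 2) ∂P := by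
        refine integral_mono_ae integrable_condExp (integrable_const _) ?_
        filter_upwards [hpull, hmean, hsub] with ω hω hωmean hωsub
        rw [hωmean] at hωsub
        rw [hω, Pi.mul_apply]
        refine (mul_le_mul_of_nonneg_left hωsub (Real.exp_pos _).le).trans_eq ?_
        rw [← Real.exp_add]
        congr 1
        ring
    _ = _ := by simp

/-- Two-sided Chernoff bound for a random variable with sub-gaussian moment generating function. -/
lemma measureReal_abs_gt_le {Ω : Type*} {m0 : MeasurableSpace Ω} {P : Measure Ω}
    [IsProbabilityMeasure P] {X : Ω → ℝ} {C : NNReal}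
    (hX : ProbabilityTheory.HasSubgaussianMGF X C P) {τ : ℝ} (hτ : 0 ≤ τ) :
    P.real {ω | τ < |X ω|} ≤ 2 * Real.exp (-τ ^ 2 / (2 * C)) := by
  have hsubset : {ω | τ < |X ω|} ⊆ {ω | τ ≤ X ω} ∪ {ω | τ ≤ (-X) ω} := by
    intro ω hω
    exact (lt_abs.1 hω).imp (fun h : τ < X ω => h.le) (fun h : τ < -X ω => h.le)
  calc _ ≤ P.real {ω | τ ≤ X ω} + P.real {ω | τ ≤ (-X) ω} :=
        (measureReal_mono hsubset).trans (measureReal_union_le _ _)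
    _ ≤ _ := by
      rw [two_mul]
      exact add_le_add (hX.measure_ge_le hτ) (hX.neg.measure_ge_le hτ)

/-- Proposition 9 (uniform concentration): for a self-neutralizing,
conditionally sub-gaussian process, the probability that some non-increasing
vector `r ∈ [0,1]^k` has `|Σ_j r_j Δ_j| > τ` is at most
`2(k+1) exp(−τ²/(2 Σ_j c_j²))`. -/
theorem uniform_concentration {Ω : Type*} [m0 : MeasurableSpace Ω]
    (P : Measure Ω) [IsProbabilityMeasure P]
    (k : ℕ) (hk : 1 ≤ k)
    (𝒜 : ℕ → MeasurableSpace Ω) (h𝒜mono : Monotone 𝒜) (h𝒜le : ∀ j, 𝒜 j ≤ m0)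
    (Δ : ℕ → Ω → ℝ)
    (hmeas : ∀ j ∈ Icc 1 k, Measurable[𝒜 j] (Δ j))
    (hint : ∀ j ∈ Icc 1 k, Integrable (Δ j) P)
    (c : ℕ → ℝ) (hc : ∀ j ∈ Icc 1 k, 0 ≤ c j)
    -- self-neutralizing
    (hSN : ∀ j ∈ Icc 1 k,
      P[Δ j|𝒜 (j - 1)] =ᵐ[P] fun ω => -∑ i ∈ Icc 1 (j - 1), Δ i ω)
    -- conditionally sub-gaussian
    (hSG : ∀ j ∈ Icc 1 k, ∀ γ : ℝ,
      Integrable (fun ω => Real.exp (γ * Δ j ω)) P ∧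
      (P[fun ω => Real.exp (γ * Δ j ω)|𝒜 (j - 1)]) ≤ᵐ[P]
        fun ω => Real.exp (γ * (P[Δ j|𝒜 (j - 1)]) ω + γ ^ 2 * c j ^ 2 / 2))
    -- integrability of the partial sums' exponential moments
    (hintexp : ∀ j ∈ Icc 1 k, ∀ γ : ℝ,
      Integrable (fun ω => Real.exp (γ * ∑ i ∈ Icc 1 j, Δ i ω)) P)
    (hcpos : 0 < ∑ j ∈ Icc 1 k, c j ^ 2)
    (τ : ℝ) (hτ : 0 < τ) :
    P {ω | ∃ r : ℕ → ℝ,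
          (∀ j ∈ Icc 1 k, 0 ≤ r j ∧ r j ≤ 1)
          ∧ (∀ j ∈ Icc 1 (k - 1), r (j + 1) ≤ r j)
          ∧ τ < |∑ j ∈ Icc 1 k, r j * Δ j ω|}
      ≤ ENNReal.ofReal
          (2 * (k + 1) * Real.exp (-τ ^ 2 / (2 * ∑ j ∈ Icc 1 k, c j ^ 2))) := by
  have hC : 0 ≤ ∑ j ∈ Icc 1 k, c j ^ 2 := hcpos.le
  have hsubG : ∀ n ∈ Icc 1 k, ProbabilityTheory.HasSubgaussianMGF
      (fun ω => ∑ i ∈ Icc 1 n, Δ i ω) ⟨∑ j ∈ Icc 1 k, c j ^ 2, hC⟩ P := by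
    intro n hn
    refine ⟨hintexp n hn, fun γ => ?_⟩
    obtain ⟨hn1, hnk⟩ := mem_Icc.1 hn
    have hsplit : ∀ ω, ∑ i ∈ Icc 1 n, Δ i ω = ∑ i ∈ Icc 1 (n - 1), Δ i ω + Δ n ω := by
      intro ω
      obtain ⟨p, rfl⟩ := Nat.exists_eq_add_of_le' hn1
      exact sum_Icc_succ_top (by omega) _
    have hprefix : Measurable[𝒜 (n - 1)] fun ω => ∑ i ∈ Icc 1 (n - 1), Δ i ω := by
      refine Finset.measurable_sum _ fun i hi => ?_
      obtain ⟨hi1, hin⟩ := mem_Icc.1 hi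
      exact (hmeas i (mem_Icc.2 ⟨hi1, by omega⟩)).mono (h𝒜mono hin) le_rfl
    have hexp := hintexp n hn γ
    simp only [hsplit] at hexp
    have hmgf := integral_exp_mul_add_le (h𝒜le (n - 1)) hprefix (hSN n hn) (hSG n hn γ).1 hexp
      (hSG n hn γ).2
    simp only [ProbabilityTheory.mgf, hsplit]
    refine hmgf.trans (Real.exp_le_exp.2 ?_)
    have hcn : c n ^ 2 ≤ ∑ j ∈ Icc 1 k, c j ^ 2 :=
      single_le_sum (f := fun j => c j ^ 2) (fun j _ => sq_nonneg _) hn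
    change _ ≤ (∑ j ∈ Icc 1 k, c j ^ 2) * γ ^ 2 / 2
    nlinarith [mul_le_mul_of_nonneg_left hcn (sq_nonneg γ)]
  set B := Real.exp (-τ ^ 2 / (2 * ∑ j ∈ Icc 1 k, c j ^ 2))
  rw [← ofReal_measureReal]
  refine ENNReal.ofReal_le_ofReal ?_
  calc _ ≤ P.real (⋃ n ∈ Icc 1 k, {ω | τ < |∑ i ∈ Icc 1 n, Δ i ω|}) := by
        refine measureReal_mono ?_ (measure_ne_top P _)
        rintro ω ⟨r, hr, hanti, hlt⟩
        by_contra hω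
        simp only [Set.mem_iUnion, Set.mem_ofPred_eq, not_exists, not_lt] at hω
        exact hlt.not_ge (abs_sum_mul_le_of_abs_sum_le hk hr hanti hω)
    _ ≤ ∑ n ∈ Icc 1 k, P.real {ω | τ < |∑ i ∈ Icc 1 n, Δ i ω|} :=
        measureReal_biUnion_finset_le _ _
    _ ≤ ∑ _n ∈ Icc 1 k, 2 * B :=
        sum_le_sum fun n hn => measureReal_abs_gt_le (hsubG n hn) hτ.le
    _ = 2 * k * B := by simp; ring
    _ ≤ 2 * (k + 1) * B := by
        have : 0 < B := Real.exp_pos _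
        gcongr
        linarith
end

section
/- For every j ∈ {1,…,k}, E[n̂_j − n_j | 𝒜_{j−1}] = −Σ_{i=1}^{j−1} (n̂_i − n_i) almost surely; that is, the estimation-error process (n̂_j − n_j)_{j=1}^k is self-neutralizing. -/
open Finset MeasureTheory

/-- The debiased estimators are adapted and integrable. -/
theorem debiased_estimator_measurable_integrable {Ω : Type*} [m0 : MeasurableSpace Ω]
    {P : Measure Ω} {k : ℕ} {𝒜 : ℕ → MeasurableSpace Ω} (h𝒜mono : Monotone 𝒜)
    {q : ℕ → ℝ} {D nhat : ℕ → Ω → ℝ}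
    (hmeas : ∀ j ∈ Icc 1 k, Measurable[𝒜 j] (D j))
    (hint : ∀ j ∈ Icc 1 k, Integrable (D j) P)
    (hnhat : ∀ j ∈ Icc 1 k, ∀ ω,
      nhat j ω = D j ω / q j - ∑ i ∈ Icc 1 (j - 1), (nhat i ω - D i ω)) :
    ∀ j ∈ Icc 1 k, Measurable[𝒜 j] (nhat j) ∧ Integrable (nhat j) P := by
  intro j
  induction j using Nat.strong_induction_on with
  | _ j ih =>
    intro hj
    have hlt : ∀ i ∈ Icc 1 (j - 1), i < j ∧ i ∈ Icc 1 k := by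
      intro i hi
      simp only [Finset.mem_Icc] at hi hj ⊢
      omega
    rw [funext (hnhat j hj)]
    constructor
    · refine ((hmeas j hj).div_const _).sub (Finset.measurable_fun_sum _ fun i hi => ?_)
      obtain ⟨hij, hik⟩ := hlt i hi
      exact ((ih i hij hik).1.sub (hmeas i hik)).mono (h𝒜mono hij.le) le_rfl
    · refine ((hint j hj).div_const _).sub (integrable_finsetSum _ fun i hi => ?_)
      obtain ⟨hij, hik⟩ := hlt i hi
      exact (ih i hij hik).2.sub (hint i hik)

/-- Proposition 10: the estimation-error process `(n̂_j − n_j)` of the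
debiased estimators is self-neutralizing:
`E[n̂_j − n_j | 𝒜_{j−1}] = −Σ_{i<j} (n̂_i − n_i)` a.s. -/
theorem estimation_error_self_neutralizing {Ω : Type*} [m0 : MeasurableSpace Ω]
    (P : Measure Ω) [IsProbabilityMeasure P]
    (k : ℕ) (hk : 1 ≤ k)
    (𝒜 : ℕ → MeasurableSpace Ω) (h𝒜mono : Monotone 𝒜) (h𝒜le : ∀ j, 𝒜 j ≤ m0)
    (n q : ℕ → ℝ) (hq : ∀ j ∈ Icc 1 k, 0 < q j ∧ q j ≤ 1)
    (D : ℕ → Ω → ℝ)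
    (hmeas : ∀ j ∈ Icc 1 k, Measurable[𝒜 j] (D j))
    (hint : ∀ j ∈ Icc 1 k, Integrable (D j) P)
    -- conditional mean of the demand at the j-th price
    (hD : ∀ j ∈ Icc 1 k,
      P[D j|𝒜 (j - 1)] =ᵐ[P]
        fun ω => q j * ((∑ i ∈ Icc 1 j, n i) - ∑ i ∈ Icc 1 (j - 1), D i ω))
    -- the debiased estimators
    (nhat : ℕ → Ω → ℝ)
    (hnhat : ∀ j ∈ Icc 1 k, ∀ ω,
      nhat j ω = D j ω / q j - ∑ i ∈ Icc 1 (j - 1), (nhat i ω - D i ω)) :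
    ∀ j ∈ Icc 1 k,
      P[fun ω => nhat j ω - n j|𝒜 (j - 1)] =ᵐ[P]
        fun ω => -∑ i ∈ Icc 1 (j - 1), (nhat i ω - n i) := by
  intro j hj
  have hadapted := debiased_estimator_measurable_integrable h𝒜mono hmeas hint hnhat
  have hpast : ∀ i ∈ Icc 1 (j - 1), i ≤ j - 1 ∧ i ∈ Icc 1 k := by
    intro i hi
    simp only [Finset.mem_Icc] at hi hj ⊢
    omega
  set g : Ω → ℝ := fun ω => ∑ i ∈ Icc 1 (j - 1), (nhat i ω - D i ω) + n j with hg
  have hg_meas : Measurable[𝒜 (j - 1)] g := by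
    refine (Finset.measurable_fun_sum _ fun i hi => ?_).add_const _
    obtain ⟨hij, hik⟩ := hpast i hi
    exact ((hadapted i hik).1.sub (hmeas i hik)).mono (h𝒜mono hij) le_rfl
  have hg_int : Integrable g P := by
    refine (integrable_finsetSum _ fun i hi => ?_).add (integrable_const _)
    obtain ⟨-, hik⟩ := hpast i hi
    exact (hadapted i hik).2.sub (hint i hik)
  have hdecomp : (fun ω => nhat j ω - n j) = (q j)⁻¹ • D j - g := by
    funext ω
    simp only [hnhat j hj ω, hg, Pi.sub_apply, Pi.smul_apply, smul_eq_mul]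
    ring
  have hsum : ∑ i ∈ Icc 1 j, n i = ∑ i ∈ Icc 1 (j - 1), n i + n j := by
    obtain ⟨l, rfl⟩ := Nat.exists_eq_add_of_le' (Finset.mem_Icc.mp hj).1
    exact Finset.sum_Icc_succ_top (Nat.le_add_left 1 l) n
  rw [hdecomp]
  filter_upwards [condExp_sub ((hint j hj).smul (q j)⁻¹) hg_int (𝒜 (j - 1)),
    condExp_smul (q j)⁻¹ (D j) (𝒜 (j - 1)) (μ := P), hD j hj] with ω hsub hsmul hmean
  rw [hsub, Pi.sub_apply, hsmul, Pi.smul_apply, hmean,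
    condExp_of_stronglyMeasurable (h𝒜le _) hg_meas.stronglyMeasurable hg_int,
    smul_eq_mul, inv_mul_cancel_left₀ (hq j hj).1.ne', hsum, hg]
  simp only [Finset.sum_sub_distrib]
  ring
end

section
/- For every j ∈ {1,…,k}, E[n̂_j] = n_j; that is, the debiased estimators are unbiased. -/
open Finset MeasureTheory

/-- Lemma 1 (Unbiasedness): the debiased estimators satisfy `E[n̂_j] = n_j`
for every `j ∈ {1,…,k}`. -/
theorem estimators_unbiased {Ω : Type*} [m0 : MeasurableSpace Ω]
    (P : Measure Ω) [IsProbabilityMeasure P]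
    (k : ℕ) (hk : 1 ≤ k)
    (𝒜 : ℕ → MeasurableSpace Ω) (h𝒜mono : Monotone 𝒜) (h𝒜le : ∀ j, 𝒜 j ≤ m0)
    (n q : ℕ → ℝ) (hq : ∀ j ∈ Icc 1 k, 0 < q j ∧ q j ≤ 1)
    (D : ℕ → Ω → ℝ)
    (hmeas : ∀ j ∈ Icc 1 k, Measurable[𝒜 j] (D j))
    (hint : ∀ j ∈ Icc 1 k, Integrable (D j) P)
    -- conditional mean of the demand at the j-th price
    (hD : ∀ j ∈ Icc 1 k,
      P[D j|𝒜 (j - 1)] =ᵐ[P]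
        fun ω => q j * ((∑ i ∈ Icc 1 j, n i) - ∑ i ∈ Icc 1 (j - 1), D i ω))
    -- the debiased estimators
    (nhat : ℕ → Ω → ℝ)
    (hnhat : ∀ j ∈ Icc 1 k, ∀ ω,
      nhat j ω = D j ω / q j - ∑ i ∈ Icc 1 (j - 1), (nhat i ω - D i ω)) :
    ∀ j ∈ Icc 1 k, ∫ ω, nhat j ω ∂P = n j := by
  suffices h : ∀ j ∈ Icc 1 k, Integrable (nhat j) P ∧ ∫ ω, nhat j ω ∂P = n j from
    fun j hj => (h j hj).2
  intro j
  induction j using Nat.strong_induction_on with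
  | _ j ih =>
  intro hj
  obtain ⟨hj1, hjk⟩ := mem_Icc.1 hj
  obtain ⟨m, rfl⟩ := Nat.exists_eq_add_of_le' hj1
  have hlt : ∀ i ∈ Icc 1 m, i < m + 1 ∧ i ∈ Icc 1 k := fun i hi => by
    simp only [mem_Icc] at hi ⊢
    omega
  have hDint : ∀ i ∈ Icc 1 m, Integrable (D i) P := fun i hi => hint i (hlt i hi).2
  have hprev : ∀ i ∈ Icc 1 m, Integrable (nhat i) P ∧ ∫ ω, nhat i ω ∂P = n i :=
    fun i hi => ih i (hlt i hi).1 (hlt i hi).2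
  have hdiff : ∀ i ∈ Icc 1 m, Integrable (fun ω => nhat i ω - D i ω) P :=
    fun i hi => (hprev i hi).1.sub (hDint i hi)
  have hmean : ∫ ω, D (m + 1) ω ∂P =
      q (m + 1) * (∑ i ∈ Icc 1 (m + 1), n i - ∑ i ∈ Icc 1 m, ∫ ω, D i ω ∂P) := by
    have hcond := hD (m + 1) hj
    rw [Nat.add_sub_cancel] at hcond
    rw [← integral_condExp (h𝒜le m), integral_congr_ae hcond, integral_const_mul,
      integral_sub (integrable_const _) (integrable_finsetSum _ hDint),
      integral_finsetSum _ hDint]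
    simp
  have hrec : nhat (m + 1) =
      fun ω => D (m + 1) ω / q (m + 1) - ∑ i ∈ Icc 1 m, (nhat i ω - D i ω) :=
    funext (hnhat (m + 1) hj)
  have hscaled := (hint (m + 1) hj).div_const (q (m + 1))
  have hsum := integrable_finsetSum _ hdiff
  rw [hrec]
  refine ⟨hscaled.sub hsum, ?_⟩
  have hsub : ∀ i ∈ Icc 1 m, ∫ ω, (nhat i ω - D i ω) ∂P = n i - ∫ ω, D i ω ∂P :=
    fun i hi => by rw [integral_sub (hprev i hi).1 (hDint i hi), (hprev i hi).2]
  rw [integral_sub hscaled hsum, integral_div, hmean,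
    mul_div_cancel_left₀ _ (hq (m + 1) hj).1.ne', integral_finsetSum _ hdiff,
    sum_congr rfl hsub, sum_sub_distrib, sum_Icc_succ_top (by omega)]
  ring
end

section
/- For every real q with 0 < q ≤ 1, every natural number N, and every real γ with 0 < γ ≤ 1.79·q, it holds that (1 + q·(e^{γ/q} − 1))^N ≤ exp(γ·N + γ²·N/q). -/
theorem Real.exp_le_one_add_add_sq {x : ℝ} (hx0 : 0 ≤ x) (hx : x ≤ 1.79) :
    Real.exp x ≤ 1 + x + x ^ 2 := by
  have taylor : |Real.exp x - ∑ m ∈ Finset.range 10, x ^ m / m.factorial|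
      ≤ |x| ^ 10 / (Nat.factorial 10) * 2 := by
    have h := Complex.exp_bound' (x := (x : ℂ)) (n := 10) (by
      rw [Complex.norm_real, Real.norm_eq_abs, abs_of_nonneg hx0]
      norm_num at hx ⊢
      linarith)
    rw [Complex.norm_real, Real.norm_eq_abs] at h
    exact_mod_cast h
  have upper := (abs_le.mp taylor).2
  rw [abs_of_nonneg hx0] at upper
  have pow_bound (k : ℕ) : x ^ (k + 2) ≤ 1.79 ^ k * x ^ 2 := by
    rw [pow_add]
    gcongr
  have h3 := pow_bound 1
  have h4 := pow_bound 2
  have h5 := pow_bound 3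
  have h6 := pow_bound 4
  have h7 := pow_bound 5
  have h8 := pow_bound 6
  have h9 := pow_bound 7
  have h10 := pow_bound 8
  norm_num [Finset.sum_range_succ, Nat.factorial] at upper h3 h4 h5 h6 h7 h8 h9 h10
  linarith [sq_nonneg x]

/-- MGF bound for a binomial (core of Proposition 11, conditional
sub-gaussianity of the estimation-error process): for `0 < q ≤ 1`, `N : ℕ`,
and `0 < γ ≤ 1.79 q`, `(1 + q(e^{γ/q} − 1))^N ≤ exp(γN + γ²N/q)`. -/
theorem binomial_mgf_bound (q : ℝ) (hq0 : 0 < q) (hq1 : q ≤ 1)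
    (N : ℕ) (γ : ℝ) (hγ0 : 0 < γ) (hγ : γ ≤ 1.79 * q) :
    (1 + q * (Real.exp (γ / q) - 1)) ^ N
      ≤ Real.exp (γ * N + γ ^ 2 * N / q) := by
  have hexp := Real.exp_le_one_add_add_sq (div_pos hγ0 hq0).le ((div_le_iff₀ hq0).mpr hγ)
  have hone : 1 ≤ Real.exp (γ / q) := Real.one_le_exp (div_pos hγ0 hq0).le
  have hbase : 0 ≤ 1 + q * (Real.exp (γ / q) - 1) := by
    have := mul_nonneg hq0.le (sub_nonneg.mpr hone)
    linarith
  calc (1 + q * (Real.exp (γ / q) - 1)) ^ N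
      ≤ Real.exp (γ + γ ^ 2 / q) ^ N := by
        refine pow_le_pow_left₀ hbase ?_ N
        calc 1 + q * (Real.exp (γ / q) - 1)
            ≤ 1 + q * (γ / q + (γ / q) ^ 2) := by
              gcongr
              linarith
          _ = γ + γ ^ 2 / q + 1 := by
              field_simp
              ring
          _ ≤ Real.exp (γ + γ ^ 2 / q) := Real.add_one_le_exp _
    _ = Real.exp (γ * N + γ ^ 2 * N / q) := by
        rw [← Real.exp_nat_mul]
        ring_nf
end
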